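/- arXiv:1611.03023 — 3 statements merged into one kernel-verified Lean document; each statement's English description precedes it below -/
import Mathlib

section
/- Under the stated assumptions (D1)–(D3) and (C), the eigenpair is P-essentially unique: if (α₁, x₁) and (α₂, x₂) are any pairs of (not necessarily measurable) functions with α_i(ω) ≥ 0, x_i(ω) ∈ K(ω), ⟨φ(ω), x_i(ω)⟩ = 1, satisfying α_i(ω)·x_i(Tω) = D(ω, x_i(ω)) for P-almost all ω (i = 1, 2), then x₁(ω) = x₂(ω) and α₁(ω) = α₂(ω) for P-almost all ω. -/
open MeasureTheory Filter Topology
open scoped ENNReal Classical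

noncomputable section

/-- A cone: a set containing all nonnegative linear combinations of its elements. -/
def IsCone {E : Type*} [AddCommGroup E] [Module ℝ E] (K : Set E) : Prop :=
  ∀ x ∈ K, ∀ y ∈ K, ∀ a b : ℝ, 0 ≤ a → 0 ≤ b → a • x + b • y ∈ K

/-- A solid cone: a closed proper cone with nonempty interior. -/
def IsSolidCone {E : Type*} [NormedAddCommGroup E] [NormedSpace ℝ E] (K : Set E) : Prop :=
  IsCone K ∧ IsClosed K ∧ K ∩ (-K) = {0} ∧ (interior K).Nonempty

/-- `x ≤_K y` iff `y - x ∈ K`. -/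
def coneLE {E : Type*} [AddCommGroup E] (K : Set E) (x y : E) : Prop := y - x ∈ K

/-- `x ≺_K y` iff `x ≤_K y` and `x ≠ y`. -/
def conePrec {E : Type*} [AddCommGroup E] (K : Set E) (x y : E) : Prop :=
  coneLE K x y ∧ x ≠ y

/-- `x <_K y` iff `y - x ∈ K°`. -/
def coneLT {E : Type*} [NormedAddCommGroup E] (K : Set E) (x y : E) : Prop :=
  y - x ∈ interior K

/-- A map `D : K → L` is completely monotone if it preserves each of the three
order relations `≤_K`, `≺_K`, `<_K`. -/
def CompletelyMonotoneOn {E : Type*} [NormedAddCommGroup E] (K L : Set E) (D : E → E) : Prop :=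
  (∀ x ∈ K, ∀ y ∈ K, coneLE K x y → coneLE L (D x) (D y)) ∧
  (∀ x ∈ K, ∀ y ∈ K, conePrec K x y → conePrec L (D x) (D y)) ∧
  (∀ x ∈ K, ∀ y ∈ K, coneLT K x y → coneLT L (D x) (D y))

/-- A map `D : K → L` is strictly monotone if `x ≺_K y` implies `D x <_L D y`. -/
def ConeStrictlyMonotoneOn {E : Type*} [NormedAddCommGroup E] (K L : Set E) (D : E → E) : Prop :=
  ∀ x ∈ K, ∀ y ∈ K, conePrec K x y → coneLT L (D x) (D y)

/-- The dual cone `K* = {φ : φ(x) ≥ 0 for all x ∈ K}`. -/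
def dualCone {E : Type*} [NormedAddCommGroup E] [NormedSpace ℝ E] (K : Set E) :
    Set (E →L[ℝ] ℝ) := {φ | ∀ x ∈ K, 0 ≤ φ x}

section Cone

variable {E : Type*} [NormedAddCommGroup E] [NormedSpace ℝ E] {K L M : Set E} {x y : E}

namespace IsSolidCone

theorem zero_mem (hK : IsSolidCone K) : (0 : E) ∈ K := by
  have h : (0 : E) ∈ K ∩ (-K) := by rw [hK.2.2.1]; rfl
  exact h.1

theorem add_mem (hK : IsSolidCone K) (hx : x ∈ K) (hy : y ∈ K) : x + y ∈ K := by
  simpa using hK.1 x hx y hy 1 1 zero_le_one zero_le_one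

theorem smul_mem (hK : IsSolidCone K) {r : ℝ} (hr : 0 ≤ r) (hx : x ∈ K) : r • x ∈ K := by
  simpa using hK.1 x hx x hx r 0 hr le_rfl

theorem eq_zero_of_neg_mem (hK : IsSolidCone K) (hx : x ∈ K) (hx' : -x ∈ K) : x = 0 := by
  have h : x ∈ K ∩ (-K) := ⟨hx, hx'⟩
  rw [hK.2.2.1] at h
  exact h

theorem convex (hK : IsSolidCone K) : Convex ℝ K :=
  fun _ hx _ hy a b ha hb _ => hK.1 _ hx _ hy a b ha hb

theorem subset_closure_interior (hK : IsSolidCone K) : K ⊆ closure (interior K) := by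
  rw [hK.convex.closure_interior_eq_closure_of_nonempty_interior hK.2.2.2]
  exact subset_closure

theorem add_mem_interior (hK : IsSolidCone K) (hx : x ∈ interior K) (hy : y ∈ K) :
    x + y ∈ interior K := by
  have hopen : IsOpen ((fun z => z + y) '' interior K) :=
    (Homeomorph.addRight y).isOpenMap _ isOpen_interior
  refine interior_maximal ?_ hopen ⟨x, hx, rfl⟩
  rintro _ ⟨z, hz, rfl⟩
  exact hK.add_mem (interior_subset hz) hy

theorem smul_mem_interior (hK : IsSolidCone K) {r : ℝ} (hr : 0 < r) (hx : x ∈ interior K) :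
    r • x ∈ interior K := by
  have hopen : IsOpen ((fun z => r • z) '' interior K) :=
    (isOpenMap_smul₀ hr.ne') _ isOpen_interior
  refine interior_maximal ?_ hopen ⟨x, hx, rfl⟩
  rintro _ ⟨z, hz, rfl⟩
  exact hK.smul_mem hr.le (interior_subset hz)

end IsSolidCone

/-- The largest `r ≥ 0` with `r • y ≤_K x`. -/
def coneRatio (K : Set E) (x y : E) : ℝ := sSup {r | 0 ≤ r ∧ x - r • y ∈ K}

/-- The exponential of minus the Hilbert projective distance of `x` and `y`. -/
def coneProximity (K : Set E) (x y : E) : ℝ := coneRatio K x y * coneRatio K y x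

theorem coneRatio_nonneg (K : Set E) (x y : E) : 0 ≤ coneRatio K x y :=
  Real.sSup_nonneg fun _ h => h.1

theorem coneProximity_nonneg (K : Set E) (x y : E) : 0 ≤ coneProximity K x y :=
  mul_nonneg (coneRatio_nonneg K x y) (coneRatio_nonneg K y x)

theorem IsSolidCone.bddAbove_ratio (hK : IsSolidCone K) (hy : y ∈ K) (hy0 : y ≠ 0) :
    BddAbove {r : ℝ | 0 ≤ r ∧ x - r • y ∈ K} := by
  by_contra h
  rw [not_bddAbove_iff] at h
  choose r hr hlt using fun k : ℕ => h ((k : ℝ) + 1)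
  have hpos : ∀ k, 0 < r k := fun k => lt_trans (by positivity) (hlt k)
  have hlim : Tendsto (fun k => (r k)⁻¹) atTop (𝓝 0) := by
    refine tendsto_inv_atTop_zero.comp (tendsto_atTop_mono (fun k => ?_)
      (tendsto_natCast_atTop_atTop (R := ℝ)))
    linarith [hlt k]
  have hmem : ∀ k, (r k)⁻¹ • x - y ∈ K := fun k => by
    have := hK.smul_mem (inv_nonneg.2 (hpos k).le) (hr k).2
    rwa [smul_sub, smul_smul, inv_mul_cancel₀ (hpos k).ne', one_smul] at this
  have hneg : -y ∈ K := by
    have h1 : Tendsto (fun k => (r k)⁻¹ • x - y) atTop (𝓝 ((0 : ℝ) • x - y)) :=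
      (hlim.smul_const x).sub_const y
    simpa using hK.2.1.mem_of_tendsto h1 (Eventually.of_forall hmem)
  exact hy0 (hK.eq_zero_of_neg_mem hy hneg)

theorem IsSolidCone.le_coneRatio (hK : IsSolidCone K) (hy : y ∈ K) (hy0 : y ≠ 0) {r : ℝ}
    (hr : 0 ≤ r) (h : x - r • y ∈ K) : r ≤ coneRatio K x y :=
  le_csSup (hK.bddAbove_ratio hy hy0) ⟨hr, h⟩

theorem IsSolidCone.sub_coneRatio_smul_mem (hK : IsSolidCone K) (hx : x ∈ K) (hy : y ∈ K)
    (hy0 : y ≠ 0) : x - coneRatio K x y • y ∈ K := by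
  have hclosed : IsClosed {r : ℝ | 0 ≤ r ∧ x - r • y ∈ K} :=
    isClosed_Ici.inter (hK.2.1.preimage (by fun_prop : Continuous fun r : ℝ => x - r • y))
  exact (hclosed.csSup_mem ⟨0, le_rfl, by simpa using hx⟩ (hK.bddAbove_ratio hy hy0)).2

theorem IsSolidCone.le_coneRatio_iff (hK : IsSolidCone K) (hx : x ∈ K) (hy : y ∈ K)
    (hy0 : y ≠ 0) {r : ℝ} (hr : 0 ≤ r) : r ≤ coneRatio K x y ↔ x - r • y ∈ K := by
  refine ⟨fun h => ?_, hK.le_coneRatio hy hy0 hr⟩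
  have := hK.add_mem (hK.sub_coneRatio_smul_mem hx hy hy0) (hK.smul_mem (sub_nonneg.2 h) hy)
  convert this using 1
  module

theorem IsSolidCone.lt_coneRatio (hK : IsSolidCone K) (hy : y ∈ K) (hy0 : y ≠ 0) {r : ℝ}
    (hr : 0 ≤ r) (h : x - r • y ∈ interior K) : r < coneRatio K x y := by
  have hcont : ContinuousAt (fun s : ℝ => x - s • y) r := by fun_prop
  have hev : ∀ᶠ s in 𝓝[>] r, x - s • y ∈ K :=
    (hcont.eventually (mem_interior_iff_mem_nhds.1 h)).filter_mono nhdsWithin_le_nhds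
  obtain ⟨s, hs, hrs⟩ := (hev.and self_mem_nhdsWithin).exists
  exact lt_of_lt_of_le hrs (hK.le_coneRatio hy hy0 (hr.trans (le_of_lt hrs)) hs)

theorem IsSolidCone.eq_smul_of_one_le_coneProximity (hK : IsSolidCone K) (hx : x ∈ K)
    (hx0 : x ≠ 0) (hy : y ∈ K) (hy0 : y ≠ 0) (h : 1 ≤ coneProximity K x y) :
    coneProximity K x y = 1 ∧ y = coneRatio K y x • x := by
  have ha := hK.sub_coneRatio_smul_mem hx hy hy0
  have hb := hK.sub_coneRatio_smul_mem hy hx hx0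
  have hb0 := coneRatio_nonneg K y x
  unfold coneProximity at h ⊢
  set a := coneRatio K x y
  set b := coneRatio K y x
  have h1 := hK.smul_mem hb0 ha
  have h2 : -((a * b - 1) • y) ∈ K := by
    convert hK.add_mem h1 hb using 1
    module
  have h3 := hK.eq_zero_of_neg_mem (hK.smul_mem (sub_nonneg.2 h) hy) h2
  have h4 : a * b = 1 := by
    rcases smul_eq_zero.1 h3 with h | h
    · linarith
    · exact absurd h hy0
  refine ⟨h4, ?_⟩
  refine sub_eq_zero.1 (hK.eq_zero_of_neg_mem hb ?_)
  convert h1 using 1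
  rw [smul_sub, smul_smul, mul_comm b a, h4]
  module

theorem IsSolidCone.coneProximity_le_one (hK : IsSolidCone K) (hx : x ∈ K)
    (hx0 : x ≠ 0) (hy : y ∈ K) (hy0 : y ≠ 0) : coneProximity K x y ≤ 1 := by
  by_contra! h
  exact h.ne' (hK.eq_smul_of_one_le_coneProximity hx hx0 hy hy0 h.le).1

theorem IsSolidCone.one_le_coneProximity_smul (hK : IsSolidCone K) (hx : x ∈ K) (hx0 : x ≠ 0)
    {c : ℝ} (hc : 0 < c) : 1 ≤ coneProximity K (c • x) x := by
  have h1 : c ≤ coneRatio K (c • x) x :=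
    hK.le_coneRatio hx hx0 hc.le (by simpa using hK.zero_mem)
  have h2 : c⁻¹ ≤ coneRatio K x (c • x) := by
    refine hK.le_coneRatio (hK.smul_mem hc.le hx) (smul_ne_zero hc.ne' hx0) (by positivity) ?_
    rw [smul_smul, inv_mul_cancel₀ hc.ne', one_smul, sub_self]
    exact hK.zero_mem
  calc (1 : ℝ) = c * c⁻¹ := (mul_inv_cancel₀ hc.ne').symm
    _ ≤ _ := mul_le_mul h1 h2 (by positivity) (coneRatio_nonneg _ _ _)

theorem IsSolidCone.coneProximity_le_smul (hK : IsSolidCone K) (hx : x ∈ K) (hx0 : x ≠ 0)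
    (hy : y ∈ K) (hy0 : y ≠ 0) {c d : ℝ} (hc : 0 < c) (hd : 0 < d) :
    coneProximity K x y ≤ coneProximity K (c • x) (d • y) := by
  have key : ∀ {u v : E} {c d : ℝ}, u ∈ K → v ∈ K → v ≠ 0 → 0 < c → 0 < d →
      c / d * coneRatio K u v ≤ coneRatio K (c • u) (d • v) := by
    intro u v c d hu hv hv0 hc hd
    refine hK.le_coneRatio (hK.smul_mem hd.le hv) (smul_ne_zero hd.ne' hv0)
      (mul_nonneg (by positivity) (coneRatio_nonneg _ _ _)) ?_
    convert hK.smul_mem hc.le (hK.sub_coneRatio_smul_mem hu hv hv0) using 1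
    rw [smul_smul, smul_sub, smul_smul]
    congr 2
    field_simp
  calc coneProximity K x y
      = (c / d * coneRatio K x y) * (d / c * coneRatio K y x) := by
        unfold coneProximity; field_simp
    _ ≤ _ := mul_le_mul (key hx hy hy0 hc hd) (key hy hx hx0 hd hc)
        (mul_nonneg (by positivity) (coneRatio_nonneg _ _ _)) (coneRatio_nonneg _ _ _)

theorem IsSolidCone.eventually_coneRatio_lt (hK : IsSolidCone K) {r : ℝ}
    (hy : y ∈ K) (hy0 : y ≠ 0) (h : coneRatio K x y < r) :
    ∀ᶠ p : E × E in 𝓝 (x, y), p.1 ∈ K → p.2 ∈ K → p.2 ≠ 0 → coneRatio K p.1 p.2 < r := by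
  have hr : 0 ≤ r := (coneRatio_nonneg _ _ _).trans h.le
  have hn : x - r • y ∉ K := fun hmem => absurd (hK.le_coneRatio hy hy0 hr hmem) (not_le.2 h)
  have hcont : Continuous fun p : E × E => p.1 - r • p.2 := by fun_prop
  filter_upwards [hcont.continuousAt.eventually (hK.2.1.isOpen_compl.mem_nhds hn)]
    with p hp h1 h2 h3
  by_contra! hle
  exact hp ((hK.le_coneRatio_iff h1 h2 h3 hr).1 hle)

/-- Upper semicontinuity of the proximity on nonzero vectors of a cone. -/
theorem IsSolidCone.eventually_coneProximity_lt (hK : IsSolidCone K) {s : ℝ} (hx : x ∈ K)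
    (hx0 : x ≠ 0) (hy : y ∈ K) (hy0 : y ≠ 0) (h : coneProximity K x y < s) :
    ∀ᶠ p : E × E in 𝓝 (x, y), p.1 ∈ K → p.1 ≠ 0 → p.2 ∈ K → p.2 ≠ 0 →
      coneProximity K p.1 p.2 < s := by
  have hc : Tendsto (fun ε : ℝ => (coneRatio K x y + ε) * (coneRatio K y x + ε)) (𝓝[>] 0)
      (𝓝 (coneProximity K x y)) := by
    have : Continuous fun ε : ℝ => (coneRatio K x y + ε) * (coneRatio K y x + ε) := by fun_prop
    simpa [coneProximity] using (this.tendsto 0).mono_left nhdsWithin_le_nhds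
  obtain ⟨ε, hε, hpos⟩ := ((hc.eventually_lt_const h).and self_mem_nhdsWithin).exists
  have h2 := (continuous_swap.tendsto (x, y)).eventually
    (hK.eventually_coneRatio_lt hx hx0 (lt_add_of_pos_right _ hpos))
  filter_upwards [hK.eventually_coneRatio_lt hy hy0 (lt_add_of_pos_right _ hpos), h2]
    with p hp1 hp2 hm1 hn1 hm2 hn2
  refine lt_of_le_of_lt ?_ hε
  exact mul_le_mul (hp1 hm1 hm2 hn2).le (hp2 hm2 hm1 hn1).le (coneRatio_nonneg _ _ _)
    (add_nonneg (coneRatio_nonneg _ _ _) hpos.le)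

theorem IsSolidCone.eventually_lt_coneRatio (hK : IsSolidCone K) {r : ℝ}
    (hx : x ∈ interior K) (hy : y ∈ K) (hy0 : y ≠ 0) (h : r < coneRatio K x y) :
    ∀ᶠ p : E × E in 𝓝 (x, y), p.2 ∈ K → p.2 ≠ 0 → r < coneRatio K p.1 p.2 := by
  rcases lt_or_ge r 0 with hr | hr
  · exact Eventually.of_forall fun p _ _ => hr.trans_le (coneRatio_nonneg _ _ _)
  have hpos : 0 < coneRatio K x y := hr.trans_lt h
  have hint : x - r • y ∈ interior K := by
    have h1 := hK.smul_mem_interior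
      (sub_pos.2 ((div_lt_one hpos).2 h)) hx
    have h2 := hK.smul_mem (div_nonneg hr hpos.le)
      (hK.sub_coneRatio_smul_mem (interior_subset hx) hy hy0)
    convert hK.add_mem_interior h1 h2 using 1
    rw [smul_sub, smul_smul, div_mul_cancel₀ _ hpos.ne']
    module
  have hcont : Continuous fun p : E × E => p.1 - r • p.2 := by fun_prop
  filter_upwards [hcont.continuousAt.eventually (isOpen_interior.mem_nhds hint)] with p hp h2 h3
  exact hK.lt_coneRatio h2 h3 hr hp

/-- Lower semicontinuity of the proximity on interior vectors of a cone. -/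
theorem IsSolidCone.eventually_lt_coneProximity (hK : IsSolidCone K) {s : ℝ}
    (hx : x ∈ interior K) (hx0 : x ≠ 0) (hy : y ∈ interior K) (hy0 : y ≠ 0)
    (h : s < coneProximity K x y) :
    ∀ᶠ p : E × E in 𝓝 (x, y), p.1 ∈ K → p.1 ≠ 0 → p.2 ∈ K → p.2 ≠ 0 →
      s < coneProximity K p.1 p.2 := by
  rcases lt_or_ge s 0 with hs | hs
  · exact Eventually.of_forall fun p _ _ _ _ => hs.trans_le (coneProximity_nonneg _ _ _)
  have hprod : 0 < coneRatio K x y * coneRatio K y x := hs.trans_lt h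
  have ha : 0 < coneRatio K x y := by
    rcases (coneRatio_nonneg K x y).eq_or_lt with h0 | h0
    · simp [← h0] at hprod
    · exact h0
  have hb : 0 < coneRatio K y x := pos_of_mul_pos_right hprod ha.le
  have hc : Tendsto (fun ε : ℝ => (coneRatio K x y - ε) * (coneRatio K y x - ε)) (𝓝[>] 0)
      (𝓝 (coneProximity K x y)) := by
    have : Continuous fun ε : ℝ => (coneRatio K x y - ε) * (coneRatio K y x - ε) := by fun_prop
    simpa [coneProximity] using (this.tendsto 0).mono_left nhdsWithin_le_nhds
  have hsmall : ∀ᶠ ε : ℝ in 𝓝[>] 0, ε < coneRatio K y x :=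
    (eventually_lt_nhds hb).filter_mono nhdsWithin_le_nhds
  obtain ⟨ε, ⟨hε, hεb⟩, hpos⟩ :=
    (((hc.eventually_const_lt h).and hsmall).and self_mem_nhdsWithin).exists
  have h2 := (continuous_swap.tendsto (x, y)).eventually
    (hK.eventually_lt_coneRatio hy (interior_subset hx) hx0 (sub_lt_self _ hpos))
  filter_upwards [hK.eventually_lt_coneRatio hx (interior_subset hy) hy0
    (sub_lt_self _ hpos), h2] with p hp1 hp2 hm1 hn1 hm2 hn2
  refine lt_of_lt_of_le hε ?_
  exact mul_le_mul (hp1 hm2 hn2).le (hp2 hm1 hn1).le (sub_nonneg.2 hεb.le)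
    (coneRatio_nonneg _ _ _)

/-- Continuous, positively homogeneous maps between cones preserving `≤` and `≺`. -/
structure IsMonotoneConeMap (K L : Set E) (g : E → E) : Prop where
  mapsTo : ∀ x ∈ K, g x ∈ L
  continuousOn : ContinuousOn g K
  map_smul : ∀ r : ℝ, 0 < r → ∀ x ∈ K, g (r • x) = r • g x
  le : ∀ x ∈ K, ∀ y ∈ K, coneLE K x y → coneLE L (g x) (g y)
  prec : ∀ x ∈ K, ∀ y ∈ K, conePrec K x y → conePrec L (g x) (g y)

namespace IsMonotoneConeMap

variable {g f : E → E}

theorem id (K : Set E) : IsMonotoneConeMap K K id :=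
  ⟨fun _ h => h, continuousOn_id, fun _ _ _ _ => rfl, fun _ _ _ _ h => h, fun _ _ _ _ h => h⟩

theorem comp (hf : IsMonotoneConeMap L M f) (hg : IsMonotoneConeMap K L g) :
    IsMonotoneConeMap K M (f ∘ g) where
  mapsTo x hx := hf.mapsTo _ (hg.mapsTo x hx)
  continuousOn := hf.continuousOn.comp hg.continuousOn hg.mapsTo
  map_smul r hr x hx := by
    simp only [Function.comp_apply, hg.map_smul r hr x hx, hf.map_smul r hr _ (hg.mapsTo x hx)]
  le x hx y hy h := hf.le _ (hg.mapsTo x hx) _ (hg.mapsTo y hy) (hg.le x hx y hy h)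
  prec x hx y hy h := hf.prec _ (hg.mapsTo x hx) _ (hg.mapsTo y hy) (hg.prec x hx y hy h)

theorem map_zero (hg : IsMonotoneConeMap K L g) (hK : IsSolidCone K) : g 0 = 0 := by
  have h := hg.map_smul 2 two_pos 0 hK.zero_mem
  rw [smul_zero, two_smul] at h
  simpa using h

theorem map_smul_of_nonneg (hg : IsMonotoneConeMap K L g) (hK : IsSolidCone K) {r : ℝ}
    (hr : 0 ≤ r) (hx : x ∈ K) : g (r • x) = r • g x := by
  rcases hr.eq_or_lt with rfl | h
  · simp [hg.map_zero hK]
  · exact hg.map_smul r h x hx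

theorem map_ne_zero (hg : IsMonotoneConeMap K L g) (hK : IsSolidCone K) (hx : x ∈ K)
    (hx0 : x ≠ 0) : g x ≠ 0 := by
  have h := (hg.prec 0 hK.zero_mem x hx ⟨by simpa [coneLE] using hx, hx0.symm⟩).2
  rw [hg.map_zero hK] at h
  exact h.symm

theorem coneRatio_le (hg : IsMonotoneConeMap K L g) (hK : IsSolidCone K) (hL : IsSolidCone L)
    (hx : x ∈ K) (hy : y ∈ K) (hy0 : y ≠ 0) :
    coneRatio K x y ≤ coneRatio L (g x) (g y) := by
  have hn := coneRatio_nonneg K x y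
  refine hL.le_coneRatio (hg.mapsTo y hy) (hg.map_ne_zero hK hy hy0) hn ?_
  rw [← hg.map_smul_of_nonneg hK hn hy]
  exact hg.le _ (hK.smul_mem hn hy) _ hx (hK.sub_coneRatio_smul_mem hx hy hy0)

theorem coneProximity_le (hg : IsMonotoneConeMap K L g) (hK : IsSolidCone K)
    (hL : IsSolidCone L) (hx : x ∈ K) (hx0 : x ≠ 0) (hy : y ∈ K) (hy0 : y ≠ 0) :
    coneProximity K x y ≤ coneProximity L (g x) (g y) :=
  mul_le_mul (hg.coneRatio_le hK hL hx hy hy0) (hg.coneRatio_le hK hL hy hx hx0)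
    (coneRatio_nonneg _ _ _) (coneRatio_nonneg _ _ _)

theorem map_mem_interior (hg : IsMonotoneConeMap K L g) (hK : IsSolidCone K)
    (hs : ConeStrictlyMonotoneOn K L g) (hx : x ∈ K) (hx0 : x ≠ 0) : g x ∈ interior L := by
  have h := hs 0 hK.zero_mem x hx ⟨by simpa [coneLE] using hx, hx0.symm⟩
  simpa [coneLT, hg.map_zero hK] using h

theorem coneRatio_lt (hg : IsMonotoneConeMap K L g) (hK : IsSolidCone K) (hL : IsSolidCone L)
    (hs : ConeStrictlyMonotoneOn K L g) (hx : x ∈ K) (hy : y ∈ K) (hy0 : y ≠ 0)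
    (hne : coneRatio K x y • y ≠ x) : coneRatio K x y < coneRatio L (g x) (g y) := by
  have hn := coneRatio_nonneg K x y
  refine hL.lt_coneRatio (hg.mapsTo y hy) (hg.map_ne_zero hK hy hy0) hn ?_
  rw [← hg.map_smul_of_nonneg hK hn hy]
  exact hs _ (hK.smul_mem hn hy) _ hx ⟨hK.sub_coneRatio_smul_mem hx hy hy0, hne⟩

/-- A strictly monotone map strictly increases the proximity of distinct rays. -/
theorem one_le_coneProximity_of_le (hg : IsMonotoneConeMap K L g) (hK : IsSolidCone K)
    (hL : IsSolidCone L) (hs : ConeStrictlyMonotoneOn K L g) (hx : x ∈ K) (hx0 : x ≠ 0)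
    (hy : y ∈ K) (hy0 : y ≠ 0) (h : coneProximity L (g x) (g y) ≤ coneProximity K x y) :
    1 ≤ coneProximity K x y := by
  by_cases h1 : coneRatio K x y • y = x
  · have hpos : 0 < coneRatio K x y :=
      (coneRatio_nonneg K x y).lt_of_ne' fun h0 => hx0 (by rw [← h1, h0, zero_smul])
    have := hK.one_le_coneProximity_smul hy hy0 hpos
    rwa [h1] at this
  by_cases h2 : coneRatio K y x • x = y
  · have hpos : 0 < coneRatio K y x :=
      (coneRatio_nonneg K y x).lt_of_ne' fun h0 => hy0 (by rw [← h2, h0, zero_smul])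
    have := hK.one_le_coneProximity_smul hx hx0 hpos
    rw [h2] at this
    rwa [coneProximity, mul_comm]
  · exact absurd h (not_le.2 (mul_lt_mul'' (hg.coneRatio_lt hK hL hs hx hy hy0 h1)
      (hg.coneRatio_lt hK hL hs hy hx hx0 h2) (coneRatio_nonneg _ _ _) (coneRatio_nonneg _ _ _)))

/-- A strictly monotone map which asymptotically does not increase the limiting proximity `c`
along a sequence of pairs forces `c ≥ 1`. -/
theorem one_le_of_tendsto [ProperSpace E] (hg : IsMonotoneConeMap K L g) (hK : IsSolidCone K)
    (hL : IsSolidCone L) (hs : ConeStrictlyMonotoneOn K L g) {u v : ℕ → E} {a b : ℕ → ℝ} {c : ℝ}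
    (hu : ∀ t, u t ∈ K ∧ u t ≠ 0) (hv : ∀ t, v t ∈ K ∧ v t ≠ 0)
    (ha : ∀ t, a t ≤ coneProximity K (u t) (v t))
    (hb : ∀ t, coneProximity L (g (u t)) (g (v t)) ≤ b t)
    (hac : Tendsto a atTop (𝓝 c)) (hbc : Tendsto b atTop (𝓝 c)) : 1 ≤ c := by
  have hu' : ∀ t, 0 < ‖u t‖⁻¹ := fun t => inv_pos.2 (norm_pos_iff.2 (hu t).2)
  have hv' : ∀ t, 0 < ‖v t‖⁻¹ := fun t => inv_pos.2 (norm_pos_iff.2 (hv t).2)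
  set S : Set E := K ∩ Metric.sphere 0 1 with hS
  have hScomp : IsCompact S := (isCompact_sphere (0 : E) 1).inter_left hK.2.1
  have hS0 : ∀ {z}, z ∈ S → z ≠ 0 := fun hz h0 => by
    have := hz.2
    simp [h0] at this
  have hmem : ∀ t, (‖u t‖⁻¹ • u t, ‖v t‖⁻¹ • v t) ∈ S ×ˢ S := fun t =>
    ⟨⟨hK.smul_mem (hu' t).le (hu t).1, by simp [norm_smul, (hu t).2]⟩,
      ⟨hK.smul_mem (hv' t).le (hv t).1, by simp [norm_smul, (hv t).2]⟩⟩
  obtain ⟨⟨x, y⟩, ⟨hx, hy⟩, ψ, hψ, hlim⟩ := (hScomp.prod hScomp).tendsto_subseq hmem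
  have hx0 := hS0 hx
  have hy0 := hS0 hy
  have hlow : c ≤ coneProximity K x y := by
    by_contra! hlt
    obtain ⟨s, hs1, hs2⟩ := exists_between hlt
    have h1 := hlim.eventually (hK.eventually_coneProximity_lt hx.1 hx0 hy.1 hy0 hs1)
    have h2 := (hac.comp hψ.tendsto_atTop).eventually_const_lt hs2
    obtain ⟨t, h3, h4⟩ := (h1.and h2).exists
    have hm := hmem (ψ t)
    refine lt_asymm (h3 hm.1.1 (hS0 hm.1) hm.2.1 (hS0 hm.2)) (lt_of_lt_of_le h4 ?_)
    exact (ha _).trans (hK.coneProximity_le_smul (hu _).1 (hu _).2 (hv _).1 (hv _).2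
      (hu' _) (hv' _))
  have hup : coneProximity L (g x) (g y) ≤ c := by
    by_contra! hlt
    obtain ⟨s, hs1, hs2⟩ := exists_between hlt
    have hglim : Tendsto (fun t => (g (‖u (ψ t)‖⁻¹ • u (ψ t)), g (‖v (ψ t)‖⁻¹ • v (ψ t))))
        atTop (𝓝 (g x, g y)) := by
      refine Tendsto.prodMk_nhds ?_ ?_
      · exact ((hg.continuousOn x hx.1).tendsto).comp (tendsto_nhdsWithin_iff.2
          ⟨(continuous_fst.tendsto _).comp hlim, Eventually.of_forall fun t => (hmem _).1.1⟩)
      · exact ((hg.continuousOn y hy.1).tendsto).comp (tendsto_nhdsWithin_iff.2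
          ⟨(continuous_snd.tendsto _).comp hlim, Eventually.of_forall fun t => (hmem _).2.1⟩)
    have h1 := hglim.eventually (hL.eventually_lt_coneProximity
      (hg.map_mem_interior hK hs hx.1 hx0) (hg.map_ne_zero hK hx.1 hx0)
      (hg.map_mem_interior hK hs hy.1 hy0) (hg.map_ne_zero hK hy.1 hy0) hs2)
    have h2 := (hbc.comp hψ.tendsto_atTop).eventually_lt_const hs1
    obtain ⟨t, h3, h4⟩ := (h1.and h2).exists
    have hgu := hg.mapsTo _ (hu (ψ t)).1
    have hgv := hg.mapsTo _ (hv (ψ t)).1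
    have hgu0 := hg.map_ne_zero hK (hu (ψ t)).1 (hu (ψ t)).2
    have hgv0 := hg.map_ne_zero hK (hv (ψ t)).1 (hv (ψ t)).2
    simp only [hg.map_smul _ (hu' (ψ t)) _ (hu (ψ t)).1,
      hg.map_smul _ (hv' (ψ t)) _ (hv (ψ t)).1] at h3
    have h5 := h3 (hL.smul_mem (hu' _).le hgu) (smul_ne_zero (hu' _).ne' hgu0)
      (hL.smul_mem (hv' _).le hgv) (smul_ne_zero (hv' _).ne' hgv0)
    have h6 := hL.coneProximity_le_smul (hL.smul_mem (hu' (ψ t)).le hgu)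
      (smul_ne_zero (hu' _).ne' hgu0) (hL.smul_mem (hv' (ψ t)).le hgv)
      (smul_ne_zero (hv' _).ne' hgv0) (inv_pos.2 (hu' (ψ t))) (inv_pos.2 (hv' (ψ t)))
    rw [smul_smul, smul_smul, inv_mul_cancel₀ (hu' _).ne', inv_mul_cancel₀ (hv' _).ne',
      one_smul, one_smul] at h6
    have h7 := hb (ψ t)
    simp only [Function.comp_apply] at h4
    linarith
  have h1 := hg.one_le_coneProximity_of_le hK hL hs hx.1 hx0 hy.1 hy0 (hup.trans hlow)
  have h2 := hg.coneProximity_le hK hL hx.1 hx0 hy.1 hy0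
  linarith

end IsMonotoneConeMap

/-- The infimum of the proximities of `g x` and `g y` over nonzero `x`, `y` in a countable dense
subset of `K`. -/
def minProximity [TopologicalSpace.SeparableSpace E] (K L : Set E) (g : E → E) : ℝ :=
  ⨅ p : ℕ × ℕ, if (TopologicalSpace.denseSeq E p.1 ∈ K ∧ TopologicalSpace.denseSeq E p.1 ≠ 0) ∧
      (TopologicalSpace.denseSeq E p.2 ∈ K ∧ TopologicalSpace.denseSeq E p.2 ≠ 0) then
    coneProximity L (g (TopologicalSpace.denseSeq E p.1)) (g (TopologicalSpace.denseSeq E p.2)) else 1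

section minProximity

open TopologicalSpace

variable [SeparableSpace E] {g : E → E}

theorem bddBelow_minProximity (K L : Set E) (g : E → E) :
    BddBelow (Set.range fun p : ℕ × ℕ => if (denseSeq E p.1 ∈ K ∧ denseSeq E p.1 ≠ 0) ∧
      (denseSeq E p.2 ∈ K ∧ denseSeq E p.2 ≠ 0) then
    coneProximity L (g (denseSeq E p.1)) (g (denseSeq E p.2)) else 1) := by
  refine ⟨0, ?_⟩
  rintro _ ⟨p, rfl⟩
  dsimp only
  split_ifs
  exacts [coneProximity_nonneg _ _ _, zero_le_one]

theorem minProximity_nonneg (K L : Set E) (g : E → E) : 0 ≤ minProximity K L g := by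
  refine Real.iInf_nonneg fun p => ?_
  split_ifs
  exacts [coneProximity_nonneg _ _ _, zero_le_one]

theorem exists_of_minProximity_lt {s : ℝ} (hs : s ≤ 1) (h : minProximity K L g < s) :
    ∃ x y, (x ∈ K ∧ x ≠ 0) ∧ (y ∈ K ∧ y ≠ 0) ∧ coneProximity L (g x) (g y) < s := by
  obtain ⟨p, hp⟩ := exists_lt_of_ciInf_lt h
  split_ifs at hp with hc
  · exact ⟨_, _, hc.1, hc.2, hp⟩
  · exact absurd hp (not_lt.2 hs)

theorem le_minProximity {s : ℝ} (hs : s ≤ 1)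
    (h : ∀ x y, x ∈ K → x ≠ 0 → y ∈ K → y ≠ 0 → s ≤ coneProximity L (g x) (g y)) :
    s ≤ minProximity K L g := by
  refine le_ciInf fun p => ?_
  split_ifs with hc
  exacts [h _ _ hc.1.1 hc.1.2 hc.2.1 hc.2.2, hs]

theorem IsMonotoneConeMap.minProximity_le_one (hg : IsMonotoneConeMap K L g)
    (hK : IsSolidCone K) (hL : IsSolidCone L) : minProximity K L g ≤ 1 := by
  refine (ciInf_le (bddBelow_minProximity K L g) (0, 0)).trans ?_
  dsimp only
  split_ifs with hc
  · exact hL.coneProximity_le_one (hg.mapsTo _ hc.1.1) (hg.map_ne_zero hK hc.1.1 hc.1.2)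
      (hg.mapsTo _ hc.1.1) (hg.map_ne_zero hK hc.1.1 hc.1.2)
  · exact le_rfl

theorem IsMonotoneConeMap.minProximity_le (hg : IsMonotoneConeMap K L g)
    (hK : IsSolidCone K) (hL : IsSolidCone L) (hx : x ∈ K) (hx0 : x ≠ 0) (hy : y ∈ K)
    (hy0 : y ≠ 0) : minProximity K L g ≤ coneProximity L (g x) (g y) := by
  refine le_of_forall_gt_imp_ge_of_dense fun s hs => ?_
  have hlim : Tendsto (fun p : E × E => (g p.1, g p.2)) (𝓝[K ×ˢ K] (x, y)) (𝓝 (g x, g y)) := by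
    rw [nhdsWithin_prod_eq]
    exact (((hg.continuousOn x hx).tendsto).comp tendsto_fst).prodMk_nhds
      (((hg.continuousOn y hy).tendsto).comp tendsto_snd)
  have hev := hlim.eventually (hL.eventually_coneProximity_lt (hg.mapsTo x hx)
    (hg.map_ne_zero hK hx hx0) (hg.mapsTo y hy) (hg.map_ne_zero hK hy hy0) hs)
  obtain ⟨U, hU, hUxy, hUs⟩ := mem_nhdsWithin.1 hev
  have hne : ∀ᶠ p : E × E in 𝓝 (x, y), p.1 ≠ 0 ∧ p.2 ≠ 0 :=
    (continuous_fst.continuousAt.eventually_ne hx0).and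
      (continuous_snd.continuousAt.eventually_ne hy0)
  obtain ⟨W, hWs, hW, hWxy⟩ := mem_nhds_iff.1 hne
  have hcl : (x, y) ∈ closure (interior K ×ˢ interior K) := by
    rw [closure_prod_eq]
    exact ⟨hK.subset_closure_interior hx, hK.subset_closure_interior hy⟩
  have hnon := mem_closure_iff.1 hcl (U ∩ W) (hU.inter hW) ⟨hUxy, hWxy⟩
  obtain ⟨p, hp⟩ := ((denseRange_denseSeq E).prodMap (denseRange_denseSeq E)).exists_mem_open
    ((hU.inter hW).inter (isOpen_interior.prod isOpen_interior)) hnon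
  obtain ⟨⟨hpU, hpW⟩, hp1, hp2⟩ := hp
  have hp1 := interior_subset hp1
  have hp2 := interior_subset hp2
  have hn := hWs hpW
  refine (ciInf_le (bddBelow_minProximity K L g) p).trans ?_
  rw [if_pos ⟨⟨hp1, hn.1⟩, ⟨hp2, hn.2⟩⟩]
  exact (hUs ⟨hpU, hp1, hp2⟩ (hg.mapsTo _ hp1) (hg.map_ne_zero hK hp1 hn.1)
    (hg.mapsTo _ hp2) (hg.map_ne_zero hK hp2 hn.2)).le

end minProximity

end Cone

section Cocycle

variable {E Ω : Type*} [NormedAddCommGroup E] [NormedSpace ℝ E]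

/-- A cocycle of monotone maps between the solid cones along the orbits of `T`. -/
structure IsConeCocycle (T : Ω → Ω) (K : Ω → Set E) (C : ℕ → Ω → E → E) : Prop where
  solid : ∀ ω, IsSolidCone (K ω)
  monotone : ∀ t ω, IsMonotoneConeMap (K ω) (K (T^[t] ω)) (C t ω)
  add : ∀ s t ω, C (s + t) ω = C s (T^[t] ω) ∘ C t ω

theorem IsConeCocycle.of_recursion {T : Ω → Ω} {K : Ω → Set E} {D : Ω → E → E}
    {C : ℕ → Ω → E → E} (hK : ∀ ω, IsSolidCone (K ω))
    (hD : ∀ ω, IsMonotoneConeMap (K ω) (K (T ω)) (D ω)) (hC0 : ∀ ω, C 0 ω = id)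
    (hCrec : ∀ t ω, C (t + 1) ω = D (T^[t] ω) ∘ C t ω) : IsConeCocycle T K C where
  solid := hK
  monotone t ω := by
    induction t with
    | zero => rw [hC0]; exact .id _
    | succ t ih =>
      rw [hCrec, Function.iterate_succ_apply']
      exact (hD _).comp ih
  add s t ω := by
    induction s with
    | zero => simp [hC0]
    | succ s ih => rw [Nat.add_right_comm, hCrec, ih, hCrec, Function.iterate_add_apply]; rfl

/-- Along an orbit of solutions of the eigenvector equation, `C t` maps the eigenvector to a
positive multiple of the eigenvector. -/
theorem IsConeCocycle.exists_pos_smul {T : Ω → Ω} {K : Ω → Set E}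
    {C : ℕ → Ω → E → E} {D : Ω → E → E} (h : IsConeCocycle T K C)
    (hD : ∀ ω, IsMonotoneConeMap (K ω) (K (T ω)) (D ω)) (hC0 : ∀ ω, C 0 ω = id)
    (hCrec : ∀ t ω, C (t + 1) ω = D (T^[t] ω) ∘ C t ω) {α : Ω → ℝ} {x : Ω → E}
    (hα : ∀ ω, 0 ≤ α ω) (hx : ∀ ω, x ω ∈ K ω) (hx0 : ∀ ω, x ω ≠ 0) {ω : Ω}
    (heq : ∀ s, α (T^[s] ω) • x (T (T^[s] ω)) = D (T^[s] ω) (x (T^[s] ω))) (t : ℕ) :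
    ∃ c : ℝ, 0 < c ∧ C t ω (x ω) = c • x (T^[t] ω) := by
  induction t with
  | zero => exact ⟨1, one_pos, by simp [hC0]⟩
  | succ t ih =>
    obtain ⟨c, hc, hct⟩ := ih
    have hpos : 0 < α (T^[t] ω) := (hα _).lt_of_ne' fun h0 =>
      (hD (T^[t] ω)).map_ne_zero (h.solid _) (hx _) (hx0 _) (by rw [← heq, h0, zero_smul])
    refine ⟨c * α (T^[t] ω), mul_pos hc hpos, ?_⟩
    rw [hCrec, Function.comp_apply, hct, (hD _).map_smul c hc _ (hx _), ← heq, smul_smul,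
      Function.iterate_succ_apply']

theorem IsConeCocycle.measurable_apply [MeasurableSpace Ω] [MeasurableSpace E] {T : Ω → Ω}
    {K : Ω → Set E} {D : Ω → E → E} {C : ℕ → Ω → E → E} (h : IsConeCocycle T K C) (hT : Measurable T)
    (hC0 : ∀ ω, C 0 ω = id) (hCrec : ∀ t ω, C (t + 1) ω = D (T^[t] ω) ∘ C t ω)
    (hKgraph : MeasurableSet {p : Ω × E | p.2 ∈ K p.1})
    (hDmeas : Measurable fun p : Ω × E => if p.2 ∈ K p.1 then D p.1 p.2 else 0) (t : ℕ) (q : E) :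
    Measurable fun ω => if q ∈ K ω then C t ω q else 0 := by
  have hq : MeasurableSet {ω | q ∈ K ω} :=
    (measurable_id.prodMk measurable_const : Measurable fun ω : Ω => (ω, q)) hKgraph
  induction t with
  | zero =>
    simp only [hC0, id]
    exact Measurable.ite hq measurable_const measurable_const
  | succ t ih =>
    have hite : Measurable fun ω => if q ∈ K ω then
        (fun p : Ω × E => if p.2 ∈ K p.1 then D p.1 p.2 else 0)
          (T^[t] ω, if q ∈ K ω then C t ω q else 0) else 0 :=
      Measurable.ite hq (hDmeas.comp ((hT.iterate t).prodMk ih)) measurable_const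
    convert hite using 1
    funext ω
    by_cases hm : q ∈ K ω
    · simp [hm, hCrec, (h.monotone t ω).mapsTo q hm]
    · simp [hm]

variable [TopologicalSpace.SeparableSpace E]

/-- The infimum of the proximities in the image of `C t ω`. -/
def cocycleProximity (T : Ω → Ω) (K : Ω → Set E) (C : ℕ → Ω → E → E) (t : ℕ) (ω : Ω) : ℝ :=
  minProximity (K ω) (K (T^[t] ω)) (C t ω)

/-- The limit of the infimal proximities in the images of `C t (T⁻ᵗ ω)`. -/
def pullbackProximity (T : Ω ≃ Ω) (K : Ω → Set E) (C : ℕ → Ω → E → E) (ω : Ω) : ℝ :=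
  ⨆ t, cocycleProximity T K C t (T.symm^[t] ω)

namespace IsConeCocycle

variable {K : Ω → Set E} {C : ℕ → Ω → E → E}

section Map

variable {T : Ω → Ω}

theorem cocycleProximity_le_one (h : IsConeCocycle T K C) (t : ℕ) (ω : Ω) :
    cocycleProximity T K C t ω ≤ 1 :=
  (h.monotone t ω).minProximity_le_one (h.solid _) (h.solid _)

theorem cocycleProximity_le_add (h : IsConeCocycle T K C) (s t : ℕ) (ω : Ω) :
    cocycleProximity T K C t ω ≤ cocycleProximity T K C (s + t) ω := by
  refine le_minProximity (h.cocycleProximity_le_one t ω) fun x y hx hx0 hy hy0 => ?_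
  rw [h.add, Function.iterate_add_apply]
  have hm := h.monotone t ω
  exact (hm.minProximity_le (h.solid _) (h.solid _) hx hx0 hy hy0).trans
    ((h.monotone s _).coneProximity_le (h.solid _) (h.solid _) (hm.mapsTo _ hx)
      (hm.map_ne_zero (h.solid _) hx hx0) (hm.mapsTo _ hy) (hm.map_ne_zero (h.solid _) hy hy0))

theorem cocycleProximity_iterate_le_add (h : IsConeCocycle T K C) (s t : ℕ) (ω : Ω) :
    cocycleProximity T K C s (T^[t] ω) ≤ cocycleProximity T K C (s + t) ω := by
  refine le_minProximity (h.cocycleProximity_le_one s _) fun x y hx hx0 hy hy0 => ?_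
  rw [h.add, Function.iterate_add_apply]
  have hm := h.monotone t ω
  exact (h.monotone s _).minProximity_le (h.solid _) (h.solid _) (hm.mapsTo _ hx)
      (hm.map_ne_zero (h.solid _) hx hx0) (hm.mapsTo _ hy) (hm.map_ne_zero (h.solid _) hy hy0)

end Map

variable {T : Ω ≃ Ω}

theorem bddAbove_cocycleProximity (h : IsConeCocycle T K C) (ω : Ω) :
    BddAbove (Set.range fun t => cocycleProximity T K C t (T.symm^[t] ω)) := by
  refine ⟨1, ?_⟩
  rintro _ ⟨t, rfl⟩
  exact h.cocycleProximity_le_one _ _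

theorem cocycleProximity_le_pullbackProximity (h : IsConeCocycle T K C) (t : ℕ) (ω : Ω) :
    cocycleProximity T K C t (T.symm^[t] ω) ≤ pullbackProximity T K C ω :=
  le_ciSup (h.bddAbove_cocycleProximity ω) t

theorem pullbackProximity_le_one (h : IsConeCocycle T K C) (ω : Ω) :
    pullbackProximity T K C ω ≤ 1 :=
  ciSup_le fun _ => h.cocycleProximity_le_one _ _

theorem pullbackProximity_nonneg (T : Ω ≃ Ω) (K : Ω → Set E) (C : ℕ → Ω → E → E) (ω : Ω) :
    0 ≤ pullbackProximity T K C ω :=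
  Real.iSup_nonneg fun _ => minProximity_nonneg _ _ _

theorem tendsto_cocycleProximity (h : IsConeCocycle T K C) (ω : Ω) :
    Tendsto (fun t => cocycleProximity T K C t (T.symm^[t] ω)) atTop
      (𝓝 (pullbackProximity T K C ω)) := by
  refine tendsto_atTop_ciSup (monotone_nat_of_le_succ fun t => ?_) (h.bddAbove_cocycleProximity ω)
  have := h.cocycleProximity_iterate_le_add t 1 (T.symm^[t + 1] ω)
  rwa [Function.iterate_one, Function.iterate_succ_apply', Equiv.apply_symm_apply,
    ← Function.iterate_succ_apply' T.symm] at this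

theorem cocycleProximity_add_le_pullbackProximity (h : IsConeCocycle T K C) (l t : ℕ) (ω : Ω) :
    cocycleProximity T K C (l + t) (T.symm^[t] ω) ≤ pullbackProximity T K C (T^[l] ω) := by
  have := h.cocycleProximity_le_pullbackProximity (t + l) (T^[l] ω)
  have hST : T.symm^[l] (T^[l] ω) = ω := (T.left_inv.iterate l) ω
  rwa [Function.iterate_add_apply, hST, add_comm t l] at this

theorem pullbackProximity_le_iterate (h : IsConeCocycle T K C) (l : ℕ) (ω : Ω) :
    pullbackProximity T K C ω ≤ pullbackProximity T K C (T^[l] ω) :=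
  ciSup_le fun t => (h.cocycleProximity_le_add l t _).trans
    (h.cocycleProximity_add_le_pullbackProximity l t ω)

/-- If the limiting proximity does not increase along a strictly monotone `C l ω`, it is `1`. -/
theorem one_le_pullbackProximity [ProperSpace E] (h : IsConeCocycle T K C) {ω : Ω} {l : ℕ}
    (hl : ConeStrictlyMonotoneOn (K ω) (K (T^[l] ω)) (C l ω))
    (heq : pullbackProximity T K C (T^[l] ω) = pullbackProximity T K C ω) :
    1 ≤ pullbackProximity T K C ω := by
  by_contra! hlt
  set c := pullbackProximity T K C ω with hc
  set b : ℕ → ℝ := fun t => c + (1 - c) * (1 / ((t : ℝ) + 1)) with hb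
  have hfrac : ∀ t : ℕ, 0 < 1 / ((t : ℝ) + 1) ∧ 1 / ((t : ℝ) + 1) ≤ 1 := fun t =>
    ⟨by positivity, (div_le_one (by positivity)).2 (by linarith [t.cast_nonneg (α := ℝ)])⟩
  have hblim : Tendsto b atTop (𝓝 c) := by
    simpa [hb] using (tendsto_one_div_add_atTop_nhds_zero_nat.const_mul (1 - c)).const_add c
  have hTS : ∀ t, T^[t] (T.symm^[t] ω) = ω := fun t => (T.right_inv.iterate t) ω
  have hex : ∀ t, ∃ x y, (x ∈ K (T.symm^[t] ω) ∧ x ≠ 0) ∧ (y ∈ K (T.symm^[t] ω) ∧ y ≠ 0) ∧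
      coneProximity (K (T^[l + t] (T.symm^[t] ω))) (C (l + t) (T.symm^[t] ω) x)
        (C (l + t) (T.symm^[t] ω) y) < b t := fun t => by
    refine exists_of_minProximity_lt ?_ (lt_of_le_of_lt
      (h.cocycleProximity_add_le_pullbackProximity l t ω) ?_)
    · nlinarith [(hfrac t).2]
    · rw [heq]
      nlinarith [(hfrac t).1]
  choose x y hx hy hxy using hex
  have hmon : ∀ t, IsMonotoneConeMap (K (T.symm^[t] ω)) (K ω) (C t (T.symm^[t] ω)) := fun t => by
    have := h.monotone t (T.symm^[t] ω)
    rwa [hTS] at this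
  refine hlt.not_ge ((h.monotone l ω).one_le_of_tendsto (h.solid _) (h.solid _) hl
    (u := fun t => C t (T.symm^[t] ω) (x t)) (v := fun t => C t (T.symm^[t] ω) (y t))
    (fun t => ⟨(hmon t).mapsTo _ (hx t).1, (hmon t).map_ne_zero (h.solid _) (hx t).1 (hx t).2⟩)
    (fun t => ⟨(hmon t).mapsTo _ (hy t).1, (hmon t).map_ne_zero (h.solid _) (hy t).1 (hy t).2⟩)
    (fun t => ?_) (fun t => ?_) (h.tendsto_cocycleProximity ω) hblim)
  · have := (h.monotone t (T.symm^[t] ω)).minProximity_le (h.solid _) (h.solid _)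
      (hx t).1 (hx t).2 (hy t).1 (hy t).2
    rwa [← cocycleProximity, hTS] at this
  · have := hxy t
    rw [h.add, Function.iterate_add_apply, hTS] at this
    exact this.le

theorem pullbackProximity_le_coneProximity {D : Ω → E → E} (h : IsConeCocycle T K C)
    (hD : ∀ ω, IsMonotoneConeMap (K ω) (K (T ω)) (D ω)) (hC0 : ∀ ω, C 0 ω = id)
    (hCrec : ∀ t ω, C (t + 1) ω = D (T^[t] ω) ∘ C t ω) {α β : Ω → ℝ} {x y : Ω → E}
    (hα : ∀ ω, 0 ≤ α ω) (hx : ∀ ω, x ω ∈ K ω) (hx0 : ∀ ω, x ω ≠ 0)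
    (hβ : ∀ ω, 0 ≤ β ω) (hy : ∀ ω, y ω ∈ K ω) (hy0 : ∀ ω, y ω ≠ 0) {ω : Ω}
    (heqx : ∀ t s, α (T^[s] (T.symm^[t] ω)) • x (T (T^[s] (T.symm^[t] ω))) =
      D (T^[s] (T.symm^[t] ω)) (x (T^[s] (T.symm^[t] ω))))
    (heqy : ∀ t s, β (T^[s] (T.symm^[t] ω)) • y (T (T^[s] (T.symm^[t] ω))) =
      D (T^[s] (T.symm^[t] ω)) (y (T^[s] (T.symm^[t] ω)))) :
    pullbackProximity T K C ω ≤ coneProximity (K ω) (x ω) (y ω) := by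
  refine ciSup_le fun t => ?_
  have hTS : T^[t] (T.symm^[t] ω) = ω := (T.right_inv.iterate t) ω
  obtain ⟨c, hc, hcx⟩ := h.exists_pos_smul hD hC0 hCrec hα hx hx0 (heqx t) t
  obtain ⟨d, hd, hdy⟩ := h.exists_pos_smul hD hC0 hCrec hβ hy hy0 (heqy t) t
  have h1 := (h.monotone t (T.symm^[t] ω)).minProximity_le (h.solid _) (h.solid _)
    (hx _) (hx0 _) (hy _) (hy0 _)
  rw [← cocycleProximity, hcx, hdy, hTS] at h1
  refine h1.trans ?_
  have h2 := (h.solid ω).coneProximity_le_smul ((h.solid ω).smul_mem hc.le (hx ω))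
    (smul_ne_zero hc.ne' (hx0 ω)) ((h.solid ω).smul_mem hd.le (hy ω))
    (smul_ne_zero hd.ne' (hy0 ω)) (inv_pos.2 hc) (inv_pos.2 hd)
  rwa [smul_smul, smul_smul, inv_mul_cancel₀ hc.ne', inv_mul_cancel₀ hd.ne', one_smul,
    one_smul] at h2

section Measurability

variable [MeasurableSpace Ω] [MeasurableSpace E] [BorelSpace E]
  [SecondCountableTopology E] {D : Ω → E → E}

theorem measurable_cocycleProximity {T : Ω → Ω} (h : IsConeCocycle T K C) (hT : Measurable T)
    (hC0 : ∀ ω, C 0 ω = id) (hCrec : ∀ t ω, C (t + 1) ω = D (T^[t] ω) ∘ C t ω)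
    (hKgraph : MeasurableSet {p : Ω × E | p.2 ∈ K p.1})
    (hDmeas : Measurable fun p : Ω × E => if p.2 ∈ K p.1 then D p.1 p.2 else 0) (t : ℕ) :
    Measurable (cocycleProximity T K C t) := by
  have hK : ∀ q : E, MeasurableSet {ω | q ∈ K ω} := fun q =>
    (measurable_id.prodMk measurable_const : Measurable fun ω : Ω => (ω, q)) hKgraph
  have hgood : ∀ q : E, MeasurableSet {ω | q ∈ K ω ∧ q ≠ 0} := fun q =>
    (hK q).inter (MeasurableSet.const _)
  have hratio : ∀ q r : E, Measurable fun ω =>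
      if (q ∈ K ω ∧ q ≠ 0) ∧ (r ∈ K ω ∧ r ≠ 0) then
        coneRatio (K (T^[t] ω)) (C t ω q) (C t ω r) else 1 := by
    intro q r
    refine measurable_of_Ici fun a => ?_
    have hset := (hgood q).inter (hgood r)
    rcases lt_or_ge a 0 with ha | ha
    · convert MeasurableSet.univ
      refine Set.eq_univ_of_forall fun ω => ?_
      simp only [Set.mem_preimage, Set.mem_Ici]
      split_ifs
      exacts [ha.le.trans (coneRatio_nonneg _ _ _), ha.le.trans zero_le_one]
    · have hm : MeasurableSet {ω | (T^[t] ω, (if q ∈ K ω then C t ω q else 0) -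
          a • (if r ∈ K ω then C t ω r else 0)) ∈ {p : Ω × E | p.2 ∈ K p.1}} :=
        ((hT.iterate t).prodMk
          ((h.measurable_apply hT hC0 hCrec hKgraph hDmeas t q).sub
            ((h.measurable_apply hT hC0 hCrec hKgraph hDmeas t r).const_smul a))) hKgraph
      convert (hset.inter hm).union (hset.compl.inter (MeasurableSet.const (a ≤ 1))) using 1
      ext ω
      by_cases hc : (q ∈ K ω ∧ q ≠ 0) ∧ (r ∈ K ω ∧ r ≠ 0)
      · have hiff := (h.solid (T^[t] ω)).le_coneRatio_iff ((h.monotone t ω).mapsTo _ hc.1.1)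
          ((h.monotone t ω).mapsTo _ hc.2.1)
          ((h.monotone t ω).map_ne_zero (h.solid _) hc.2.1 hc.2.2) ha
        simp [hc, hiff]
      · simp only [Set.mem_preimage, if_neg hc, Set.mem_Ici]
        constructor
        · exact fun h1 => Or.inr ⟨hc, h1⟩
        · rintro (h1 | h1)
          exacts [absurd h1.1 hc, h1.2]
  refine Measurable.iInf fun p => ?_
  convert (hratio (TopologicalSpace.denseSeq E p.1) (TopologicalSpace.denseSeq E p.2)).mul
    (hratio (TopologicalSpace.denseSeq E p.2) (TopologicalSpace.denseSeq E p.1)) using 1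
  funext ω
  rw [Pi.mul_apply]
  split_ifs <;> first | rfl | tauto | simp

theorem measurable_pullbackProximity (h : IsConeCocycle T K C) (hT : Measurable T)
    (hTsymm : Measurable T.symm)
    (hC0 : ∀ ω, C 0 ω = id) (hCrec : ∀ t ω, C (t + 1) ω = D (T^[t] ω) ∘ C t ω)
    (hKgraph : MeasurableSet {p : Ω × E | p.2 ∈ K p.1})
    (hDmeas : Measurable fun p : Ω × E => if p.2 ∈ K p.1 then D p.1 p.2 else 0) :
    Measurable (pullbackProximity T K C) :=
  Measurable.iSup fun t => (h.measurable_cocycleProximity hT hC0 hCrec hKgraph hDmeas t).comp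
    (hTsymm.iterate t)

end Measurability

end IsConeCocycle

end Cocycle

/-- A bounded measurable function which increases along a measure preserving map is invariant. -/
theorem MeasureTheory.MeasurePreserving.ae_comp_eq_of_le {Ω : Type*} [MeasurableSpace Ω]
    {P : Measure Ω} [IsFiniteMeasure P] {S : Ω → Ω} (hS : MeasurePreserving S P P) {f : Ω → ℝ}
    (hf : Measurable f) {b : ℝ} (hb : ∀ ω, ‖f ω‖ ≤ b) (hle : ∀ ω, f ω ≤ f (S ω)) :
    ∀ᵐ ω ∂P, f (S ω) = f ω := by
  have hint : Integrable f P := .of_bound hf.aestronglyMeasurable b (.of_forall hb)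
  have hint' : Integrable (fun ω => f (S ω)) P :=
    .of_bound (hf.comp hS.measurable).aestronglyMeasurable b (.of_forall fun ω => hb (S ω))
  have hI : ∫ ω, f ω ∂P = ∫ ω, f (S ω) ∂P := by
    conv_lhs => rw [← hS.map_eq]
    exact integral_map hS.measurable.aemeasurable hf.aestronglyMeasurable
  have := (integral_eq_iff_of_ae_le hint hint' (.of_forall hle)).1 hI
  filter_upwards [this] with ω hω using hω.symm

/-- **Stochastic nonlinear Perron–Frobenius theorem, uniqueness part (Theorem 1(b)).**
Any two (not necessarily measurable) normalized eigenpairs `(αᵢ, xᵢ)` with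
`αᵢ(ω) ≥ 0`, `xᵢ(ω) ∈ K(ω)`, `⟨φ(ω), xᵢ(ω)⟩ = 1` and
`αᵢ(ω) • xᵢ(Tω) = D(ω, xᵢ(ω))` a.s. coincide almost surely. -/
theorem stochastic_perron_frobenius_uniqueness
    {n : ℕ} {Ω : Type} [inst : MeasurableSpace Ω]
    [MeasurableSpace (EuclideanSpace ℝ (Fin n) →L[ℝ] ℝ)]
    [BorelSpace (EuclideanSpace ℝ (Fin n) →L[ℝ] ℝ)]
    (P : Measure Ω) [IsProbabilityMeasure P] (hPcomplete : P.IsComplete)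
    -- `T` is an automorphism of the probability space
    (T : Ω ≃ Ω) (hT : Measurable T) (hTinv : Measurable T.symm)
    (hTP : MeasurePreserving T P P)
    -- the filtration `(ℱ_t)`, invariant under `T` and containing the null sets
    (F : ℤ → MeasurableSpace Ω) (hFle : ∀ t, F t ≤ inst) (hFmono : Monotone F)
    (hFshift : ∀ t, F (t + 1) = (F t).comap T)
    (hFnull : ∀ t, ∀ N : Set Ω, P N = 0 → MeasurableSet[F t] N)
    -- the random solid cone `K(ω)`, `ℱ₀`-measurable
    (K : Ω → Set (EuclideanSpace ℝ (Fin n)))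
    (hKsolid : ∀ ω, IsSolidCone (K ω))
    (hKgraph : MeasurableSet[(F 0).prod
        (inferInstance : MeasurableSpace (EuclideanSpace ℝ (Fin n)))]
      {p : Ω × EuclideanSpace ℝ (Fin n) | p.2 ∈ K p.1})
    -- the random mapping `D(ω, ·) : K₀(ω) → K₁(ω)`
    (D : Ω → EuclideanSpace ℝ (Fin n) → EuclideanSpace ℝ (Fin n))
    (hDmaps : ∀ ω, ∀ x ∈ K ω, D ω x ∈ K (T ω))
    -- (D1): continuity in `x` and joint `ℱ₁ × 𝒱`-measurability of the extension `D̄`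
    (hD1cont : ∀ ω, ContinuousOn (D ω) (K ω))
    (hD1meas : @Measurable (Ω × EuclideanSpace ℝ (Fin n)) (EuclideanSpace ℝ (Fin n) ⊕ Unit)
      ((F 1).prod inferInstance) inferInstance
      (fun p => if p.2 ∈ K p.1 then Sum.inl (D p.1 p.2) else Sum.inr ()))
    -- (D2): positive homogeneity of degree one
    (hD2 : ∀ ω, ∀ l : ℝ, 0 < l → ∀ x ∈ K ω, D ω (l • x) = l • D ω x)
    -- (D3): complete monotonicity
    (hD3 : ∀ ω, CompletelyMonotoneOn (K ω) (K (T ω)) (D ω))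
    -- the cocycle `C(t, ω) = D_t(ω) ∘ … ∘ D₁(ω)`
    (C : ℕ → Ω → EuclideanSpace ℝ (Fin n) → EuclideanSpace ℝ (Fin n))
    (hC0 : ∀ ω, C 0 ω = id)
    (hCrec : ∀ t ω, C (t + 1) ω = D ((⇑T)^[t] ω) ∘ C t ω)
    -- (C): for a.e. `ω` some `C(l_ω, ω)` is strictly monotone
    (hCstrict : ∀ᵐ ω ∂P, ∃ l : ℕ, 0 < l ∧
      ConeStrictlyMonotoneOn (K ω) (K ((⇑T)^[l] ω)) (C l ω))
    -- the `ℱ₀`-measurable functional `φ(ω)` in the interior of the dual cone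
    (φ : Ω → (EuclideanSpace ℝ (Fin n) →L[ℝ] ℝ))
    (hφmeas : Measurable[F 0] φ)
    (hφint : ∀ ω, φ ω ∈ interior (dualCone (K ω)))
    (α₁ α₂ : Ω → ℝ) (x₁ x₂ : Ω → EuclideanSpace ℝ (Fin n))
    (hpt1 : ∀ ω, 0 ≤ α₁ ω ∧ x₁ ω ∈ K ω ∧ φ ω (x₁ ω) = 1)
    (hpt2 : ∀ ω, 0 ≤ α₂ ω ∧ x₂ ω ∈ K ω ∧ φ ω (x₂ ω) = 1)
    (heq1 : ∀ᵐ ω ∂P, α₁ ω • x₁ (T ω) = D ω (x₁ ω))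
    (heq2 : ∀ᵐ ω ∂P, α₂ ω • x₂ (T ω) = D ω (x₂ ω)) :
    ∀ᵐ ω ∂P, x₁ ω = x₂ ω ∧ α₁ ω = α₂ ω := by
  have hD : ∀ ω, IsMonotoneConeMap (K ω) (K (T ω)) (D ω) := fun ω =>
    ⟨hDmaps ω, hD1cont ω, hD2 ω, (hD3 ω).1, (hD3 ω).2.1⟩
  have h : IsConeCocycle T K C := .of_recursion hKsolid hD hC0 hCrec
  have hprod : ∀ t, (F t).prod
      (inferInstance : MeasurableSpace (EuclideanSpace ℝ (Fin n))) ≤ Prod.instMeasurableSpace :=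
    fun t => sup_le_sup (MeasurableSpace.comap_mono (hFle t)) le_rfl
  have hKgraph' : MeasurableSet {p : Ω × EuclideanSpace ℝ (Fin n) | p.2 ∈ K p.1} :=
    hprod 0 _ hKgraph
  have hDmeas : Measurable fun p : Ω × EuclideanSpace ℝ (Fin n) =>
      if p.2 ∈ K p.1 then D p.1 p.2 else 0 := by
    convert (measurable_id.sumElim (measurable_const (a := 0))).comp
      (hD1meas.mono (hprod 1) le_rfl) using 1
    funext p
    by_cases hp : p.2 ∈ K p.1 <;> simp [hp]
  have hmeas := h.measurable_pullbackProximity hT hTinv hC0 hCrec hKgraph' hDmeas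
  have hinv : ∀ᵐ ω ∂P, ∀ l : ℕ, pullbackProximity T K C (T^[l] ω) = pullbackProximity T K C ω :=
    ae_all_iff.2 fun l => (hTP.iterate l).ae_comp_eq_of_le hmeas (b := 1)
      (fun ω => by
        rw [Real.norm_of_nonneg (IsConeCocycle.pullbackProximity_nonneg T K C ω)]
        exact h.pullbackProximity_le_one ω)
      (h.pullbackProximity_le_iterate l)
  have hTsP : MeasurePreserving T.symm P P :=
    MeasurePreserving.symm (⟨T, hT, hTinv⟩ : Ω ≃ᵐ Ω) hTP
  have horbit : ∀ {p : Ω → Prop}, (∀ᵐ ω ∂P, p ω) →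
      ∀ᵐ ω ∂P, ∀ t s : ℕ, p (T^[s] (T.symm^[t] ω)) := fun hp =>
    ae_all_iff.2 fun t => ae_all_iff.2 fun s =>
      ((hTP.iterate s).comp (hTsP.iterate t)).quasiMeasurePreserving.ae hp
  have hne₁ : ∀ ω, x₁ ω ≠ 0 := fun ω h0 => by simpa [h0] using (hpt1 ω).2.2
  have hne₂ : ∀ ω, x₂ ω ≠ 0 := fun ω h0 => by simpa [h0] using (hpt2 ω).2.2
  have hx : ∀ᵐ ω ∂P, x₁ ω = x₂ ω := by
    filter_upwards [hinv, hCstrict, horbit heq1, horbit heq2] with ω hω ⟨l, _, hl⟩ h1 h2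
    have hle : 1 ≤ coneProximity (K ω) (x₁ ω) (x₂ ω) :=
      (h.one_le_pullbackProximity hl (hω l)).trans
        (h.pullbackProximity_le_coneProximity hD hC0 hCrec (fun ω => (hpt1 ω).1)
          (fun ω => (hpt1 ω).2.1) hne₁ (fun ω => (hpt2 ω).1) (fun ω => (hpt2 ω).2.1) hne₂ h1 h2)
    have hsmul := ((hKsolid ω).eq_smul_of_one_le_coneProximity (hpt1 ω).2.1 (hne₁ ω)
      (hpt2 ω).2.1 (hne₂ ω) hle).2
    have hφ := congrArg (φ ω) hsmul
    rw [map_smul, (hpt1 ω).2.2, (hpt2 ω).2.2, smul_eq_mul, mul_one] at hφ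
    rw [hsmul, ← hφ, one_smul]
  filter_upwards [hx, hTP.quasiMeasurePreserving.ae hx, heq1, heq2] with ω h1 h2 h3 h4
  refine ⟨h1, smul_left_injective ℝ (hne₂ (T ω)) ?_⟩
  change α₁ ω • x₂ (T ω) = α₂ ω • x₂ (T ω)
  rw [h4, ← h2, h3, h1]
end
end

section
/- If f : K → L is monotone, homogeneous of degree 1, and satisfies f(x) ≻_L 0 for all x ≻_K 0 (i.e. f(x) ≠ 0 for every nonzero x ∈ K), then for the normalized map g(x) = f(x)/⟨φ₂, f(x)⟩ the following holds: for all x, y ∈ Y₁, g(x) and g(y) lie in Σ_{φ₂}^L, the quantities M_L(g(x)/g(y)) = inf{β > 0 : g(x) ≤_L β g(y)} and m_L(g(x)/g(y)) = sup{α > 0 : α g(y) ≤_L g(x)} are finite and positive, and log( M_L(g(x)/g(y)) / m_L(g(x)/g(y)) ) ≤ d₁(x, y); in particular, whenever g maps Y₁ into Y₂ it is non-expansive with respect to d₁ on Y₁ and d₂ on Y₂. -/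
open MeasureTheory Filter Topology
open scoped ENNReal Classical

noncomputable section

/-- The set `{β > 0 : x ≤_K β y}`. -/
def hilbertMSet {E : Type*} [NormedAddCommGroup E] [NormedSpace ℝ E] (K : Set E) (x y : E) :
    Set ℝ := {β : ℝ | 0 < β ∧ coneLE K x (β • y)}

/-- The set `{α > 0 : α y ≤_K x}`. -/
def hilbertmSet {E : Type*} [NormedAddCommGroup E] [NormedSpace ℝ E] (K : Set E) (x y : E) :
    Set ℝ := {α : ℝ | 0 < α ∧ coneLE K (α • y) x}

/-- `M(x/y) = inf {β > 0 : x ≤_K β y}`. -/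
def hilbertM {E : Type*} [NormedAddCommGroup E] [NormedSpace ℝ E] (K : Set E) (x y : E) : ℝ :=
  sInf (hilbertMSet K x y)

/-- `m(x/y) = sup {α > 0 : α y ≤_K x}`. -/
def hilbertm {E : Type*} [NormedAddCommGroup E] [NormedSpace ℝ E] (K : Set E) (x y : E) : ℝ :=
  sSup (hilbertmSet K x y)

/-- The Hilbert–Birkhoff metric `d(x,y) = log (M(x/y) / m(x/y))`. -/
def hilbertDist {E : Type*} [NormedAddCommGroup E] [NormedSpace ℝ E] (K : Set E) (x y : E) : ℝ :=
  Real.log (hilbertM K x y / hilbertm K x y)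

theorem IsCone.smul_mem {E : Type*} [AddCommGroup E] [Module ℝ E] {K : Set E} (hK : IsCone K)
    {x : E} (hx : x ∈ K) {a : ℝ} (ha : 0 ≤ a) : a • x ∈ K := by
  simpa using hK x hx x hx a 0 ha le_rfl

/-- For a point of the interior and any vector, a small multiple of the vector may be
subtracted without leaving the set. -/
theorem exists_pos_sub_smul_mem_of_mem_interior {E : Type*} [NormedAddCommGroup E]
    [NormedSpace ℝ E] {K : Set E} {x : E} (hx : x ∈ interior K) (y : E) :
    ∃ t : ℝ, 0 < t ∧ x - t • y ∈ K := by
  have hcont : Tendsto (fun t : ℝ => x - t • y) (𝓝[>] 0) (𝓝 x) := by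
    have h : Continuous fun t : ℝ => x - t • y := by fun_prop
    simpa using (h.tendsto 0).mono_left nhdsWithin_le_nhds
  obtain ⟨t, ht, ht0⟩ :=
    ((hcont.eventually (mem_interior_iff_mem_nhds.1 hx)).and self_mem_nhdsWithin).exists
  exact ⟨t, ht0, ht⟩

/-- A functional in the interior of the dual cone is positive on the nonzero elements. -/
theorem pos_of_mem_interior_dualCone {E : Type*} [NormedAddCommGroup E] [NormedSpace ℝ E]
    {K : Set E} {φ : E →L[ℝ] ℝ} (hφ : φ ∈ interior (dualCone K)) {v : E} (hv : v ∈ K)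
    (hv0 : v ≠ 0) : 0 < φ v := by
  obtain ⟨ψ, -, hψ⟩ := exists_dual_vector ℝ v (norm_ne_zero_iff.2 hv0)
  obtain ⟨t, ht, hmem⟩ := exists_pos_sub_smul_mem_of_mem_interior hφ ψ
  have h : 0 ≤ φ v - t * ψ v := hmem v hv
  have hψv : 0 < ψ v := by simpa [hψ] using hv0
  have := mul_pos ht hψv
  linarith

theorem one_le_of_mem_hilbertMSet {E : Type*} [NormedAddCommGroup E] [NormedSpace ℝ E]
    {K : Set E} {φ : E →L[ℝ] ℝ} (hφ : φ ∈ dualCone K) {x y : E} (hx : φ x = 1) (hy : φ y = 1)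
    {β : ℝ} (hβ : β ∈ hilbertMSet K x y) : 1 ≤ β := by
  have h := hφ _ hβ.2
  simp only [map_sub, map_smul, hx, hy, smul_eq_mul, mul_one] at h
  linarith

theorem le_one_of_mem_hilbertmSet {E : Type*} [NormedAddCommGroup E] [NormedSpace ℝ E]
    {K : Set E} {φ : E →L[ℝ] ℝ} (hφ : φ ∈ dualCone K) {x y : E} (hx : φ x = 1) (hy : φ y = 1)
    {α : ℝ} (hα : α ∈ hilbertmSet K x y) : α ≤ 1 := by
  have h := hφ _ hα.2
  simp only [map_sub, map_smul, hx, hy, smul_eq_mul, mul_one] at h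
  linarith

theorem hilbertmSet_nonempty {E : Type*} [NormedAddCommGroup E] [NormedSpace ℝ E]
    {K : Set E} {x : E} (hx : x ∈ interior K) (y : E) : (hilbertmSet K x y).Nonempty :=
  exists_pos_sub_smul_mem_of_mem_interior hx y

theorem hilbertMSet_nonempty {E : Type*} [NormedAddCommGroup E] [NormedSpace ℝ E]
    {K : Set E} (hK : IsCone K) (x : E) {y : E} (hy : y ∈ interior K) :
    (hilbertMSet K x y).Nonempty := by
  obtain ⟨t, ht, hmem⟩ := exists_pos_sub_smul_mem_of_mem_interior hy x
  refine ⟨t⁻¹, inv_pos.2 ht, ?_⟩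
  have h := hK.smul_mem hmem (inv_pos.2 ht).le
  rwa [smul_sub, inv_smul_smul₀ ht.ne'] at h

/-- Rescaling both arguments of `M(u/v)` rescales the set defining it. -/
theorem mul_mem_hilbertMSet_smul {E : Type*} [NormedAddCommGroup E] [NormedSpace ℝ E]
    {L : Set E} (hL : IsCone L) {u v : E} {a b β : ℝ} (ha : 0 < a) (hb : 0 < b)
    (hβ : β ∈ hilbertMSet L u v) :
    b / a * β ∈ hilbertMSet L (a⁻¹ • u) (b⁻¹ • v) := by
  refine ⟨mul_pos (div_pos hb ha) hβ.1, ?_⟩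
  have h := hL.smul_mem hβ.2 (inv_pos.2 ha).le
  rw [smul_sub, smul_smul] at h
  rw [coneLE, smul_smul]
  convert h using 3
  field_simp

/-- Rescaling both arguments of `m(u/v)` rescales the set defining it. -/
theorem mul_mem_hilbertmSet_smul {E : Type*} [NormedAddCommGroup E] [NormedSpace ℝ E]
    {L : Set E} (hL : IsCone L) {u v : E} {a b α : ℝ} (ha : 0 < a) (hb : 0 < b)
    (hα : α ∈ hilbertmSet L u v) :
    b / a * α ∈ hilbertmSet L (a⁻¹ • u) (b⁻¹ • v) := by
  refine ⟨mul_pos (div_pos hb ha) hα.1, ?_⟩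
  have h := hL.smul_mem hα.2 (inv_pos.2 ha).le
  rw [smul_sub, smul_smul] at h
  rw [coneLE, smul_smul]
  convert h using 3
  field_simp

/-- **Theorem 2, non-expansiveness part.** If `f : K → L` is monotone, homogeneous of
degree one, and `f x ≠ 0` for every nonzero `x ∈ K`, then for all `x, y ∈ Y₁` the
normalized images `g x = f x / ⟨φ₂, f x⟩`, `g y` lie in `Σ_{φ₂}^L`, the quantities
`M_L(g x / g y)` and `m_L(g x / g y)` are finite and positive, and
`log (M_L(g x / g y) / m_L(g x / g y)) ≤ d₁(x, y)`; i.e. `g` is non-expansive for the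
Hilbert–Birkhoff metrics. -/
theorem normalized_monotone_homogeneous_nonexpansive
    {E : Type*} [NormedAddCommGroup E] [NormedSpace ℝ E] [FiniteDimensional ℝ E]
    (K L : Set E) (hK : IsSolidCone K) (hL : IsSolidCone L)
    (φ₁ φ₂ : E →L[ℝ] ℝ)
    (hφ₁ : φ₁ ∈ interior (dualCone K)) (hφ₂ : φ₂ ∈ interior (dualCone L))
    (f : E → E) (hfmaps : ∀ x ∈ K, f x ∈ L)
    (hfmono : ∀ x ∈ K, ∀ y ∈ K, coneLE K x y → coneLE L (f x) (f y))
    (hfhom : ∀ l : ℝ, 0 < l → ∀ x ∈ K, f (l • x) = l • f x)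
    (hfpos : ∀ x ∈ K, x ≠ 0 → f x ≠ 0) :
    ∀ x, x ∈ interior K → φ₁ x = 1 → ∀ y, y ∈ interior K → φ₁ y = 1 →
      ((φ₂ (f x))⁻¹ • f x ∈ L ∧ φ₂ ((φ₂ (f x))⁻¹ • f x) = 1) ∧
      ((φ₂ (f y))⁻¹ • f y ∈ L ∧ φ₂ ((φ₂ (f y))⁻¹ • f y) = 1) ∧
      (hilbertMSet L ((φ₂ (f x))⁻¹ • f x) ((φ₂ (f y))⁻¹ • f y)).Nonempty ∧
      0 < hilbertM L ((φ₂ (f x))⁻¹ • f x) ((φ₂ (f y))⁻¹ • f y) ∧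
      (hilbertmSet L ((φ₂ (f x))⁻¹ • f x) ((φ₂ (f y))⁻¹ • f y)).Nonempty ∧
      BddAbove (hilbertmSet L ((φ₂ (f x))⁻¹ • f x) ((φ₂ (f y))⁻¹ • f y)) ∧
      0 < hilbertm L ((φ₂ (f x))⁻¹ • f x) ((φ₂ (f y))⁻¹ • f y) ∧
      Real.log (hilbertM L ((φ₂ (f x))⁻¹ • f x) ((φ₂ (f y))⁻¹ • f y) /
          hilbertm L ((φ₂ (f x))⁻¹ • f x) ((φ₂ (f y))⁻¹ • f y))
        ≤ hilbertDist K x y := by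
  intro x hx hφx y hy hφy
  have hxK := interior_subset hx
  have hyK := interior_subset hy
  have hx0 : x ≠ 0 := by rintro rfl; simp at hφx
  have hy0 : y ≠ 0 := by rintro rfl; simp at hφy
  have ha := pos_of_mem_interior_dualCone hφ₂ (hfmaps x hxK) (hfpos x hxK hx0)
  have hb := pos_of_mem_interior_dualCone hφ₂ (hfmaps y hyK) (hfpos y hyK hy0)
  have hφ₁' := interior_subset hφ₁
  have hφ₂' := interior_subset hφ₂
  have hMmap : ∀ β ∈ hilbertMSet K x y, φ₂ (f y) / φ₂ (f x) * β ∈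
      hilbertMSet L ((φ₂ (f x))⁻¹ • f x) ((φ₂ (f y))⁻¹ • f y) := fun β hβ =>
    mul_mem_hilbertMSet_smul hL.1 ha hb
      ⟨hβ.1, hfhom β hβ.1 y hyK ▸ hfmono x hxK _ (hK.1.smul_mem hyK hβ.1.le) hβ.2⟩
  have hmmap : ∀ α ∈ hilbertmSet K x y, φ₂ (f y) / φ₂ (f x) * α ∈
      hilbertmSet L ((φ₂ (f x))⁻¹ • f x) ((φ₂ (f y))⁻¹ • f y) := fun α hα =>
    mul_mem_hilbertmSet_smul hL.1 ha hb
      ⟨hα.1, hfhom α hα.1 y hyK ▸ hfmono _ (hK.1.smul_mem hyK hα.1.le) x hxK hα.2⟩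
  have hgx : φ₂ ((φ₂ (f x))⁻¹ • f x) = 1 := by simp [ha.ne']
  have hgy : φ₂ ((φ₂ (f y))⁻¹ • f y) = 1 := by simp [hb.ne']
  have hgxL := hL.1.smul_mem (hfmaps x hxK) (inv_pos.2 ha).le
  have hgyL := hL.1.smul_mem (hfmaps y hyK) (inv_pos.2 hb).le
  have hc : 0 < φ₂ (f y) / φ₂ (f x) := div_pos hb ha
  generalize (φ₂ (f x))⁻¹ • f x = u at *
  generalize (φ₂ (f y))⁻¹ • f y = v at *
  generalize φ₂ (f y) / φ₂ (f x) = c at *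
  obtain ⟨β, hβ⟩ := hilbertMSet_nonempty hK.1 x hy
  obtain ⟨α, hα⟩ := hilbertmSet_nonempty hx y
  have hbddK : BddAbove (hilbertmSet K x y) :=
    ⟨1, fun _ h => le_one_of_mem_hilbertmSet hφ₁' hφx hφy h⟩
  have hbddL : BddAbove (hilbertmSet L u v) :=
    ⟨1, fun _ h => le_one_of_mem_hilbertmSet hφ₂' hgx hgy h⟩
  have hM : 0 < hilbertM L u v :=
    one_pos.trans_le (le_csInf ⟨_, hMmap β hβ⟩ fun _ h => one_le_of_mem_hilbertMSet hφ₂' hgx hgy h)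
  have hmK : 0 < hilbertm K x y := hα.1.trans_le (le_csSup hbddK hα)
  have hm : 0 < hilbertm L u v :=
    (mul_pos hc hα.1).trans_le (le_csSup hbddL (hmmap α hα))
  have hMle : hilbertM L u v ≤ c * hilbertM K x y := by
    rw [← div_le_iff₀' hc]
    refine le_csInf ⟨β, hβ⟩ fun β' hβ' => (div_le_iff₀' hc).2 ?_
    exact csInf_le ⟨0, fun _ h => h.1.le⟩ (hMmap β' hβ')
  have hmle : c * hilbertm K x y ≤ hilbertm L u v := by
    rw [← le_div_iff₀' hc]
    refine csSup_le ⟨α, hα⟩ fun α' hα' => (le_div_iff₀' hc).2 ?_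
    exact le_csSup hbddL (hmmap α' hα')
  refine ⟨⟨hgxL, hgx⟩, ⟨hgyL, hgy⟩, ⟨_, hMmap β hβ⟩, hM, ⟨_, hmmap α hα⟩, hbddL, hm, ?_⟩
  refine Real.log_le_log (div_pos hM hm) ?_
  calc hilbertM L u v / hilbertm L u v
      ≤ c * hilbertM K x y / (c * hilbertm K x y) :=
        div_le_div₀ (hM.le.trans hMle) hMle (mul_pos hc hmK) hmle
    _ = hilbertM K x y / hilbertm K x y := mul_div_mul_left _ _ hc.ne'
end
end

section
/- Under assumptions (A1)–(A3), there exists an ℱ₀-measurable mapping ξ : Ω → V such that ξ(ω) ∈ Y(ω) for all ω, the stochastic fixed-point equation ξ(Tω) = f(ω, ξ(ω)) holds for P-almost all ω, and for P-almost every ω, sup over x ∈ X₋ₘ₋₁(ω) of ρ(ω, ξ(ω), f₀(ω)f₋₁(ω)…f₋ₘ(ω)(x)) tends to 0 as m → ∞ along m ≥ m(ω); i.e., the backward iterates f₀(ω)…f₋ₘ(ω)(x) converge to ξ(ω) in the metric ρ(ω,·,·) uniformly in x ∈ X₋ₘ₋₁(ω), almost surely. -/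
open MeasureTheory Filter Topology
open scoped ENNReal Classical

noncomputable section

/-- The backward composition `f^{(m)}(ω, ·) = f₀(ω) ∘ f₋₁(ω) ∘ … ∘ f₋ₘ(ω)`, where
`f_k(ω, x) = f(T^{k-1} ω, x)` and `S = T⁻¹`; thus
`backComp S f m ω x = f(T⁻¹ω)(f(T⁻²ω)(… f(T^{-m-1}ω) x …))`. -/
def backComp {Ω V : Type*} (S : Ω → Ω) (f : Ω → V → V) : ℕ → Ω → V → V
  | 0 => fun ω x => f (S ω) x
  | m + 1 => fun ω x => backComp S f m ω (f (S^[m + 2] ω) x)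

/-- An analytic set contains closed sets of measure arbitrarily close to its outer measure. -/
theorem MeasureTheory.AnalyticSet.exists_isClosed_subset_le_measure {α : Type*}
    [TopologicalSpace α] [PolishSpace α] [MeasurableSpace α] [BorelSpace α]
    (μ : Measure α) [IsFiniteMeasure μ] {s : Set α} (hs : AnalyticSet s)
    {c : ℝ≥0∞} (hc : c < μ s) : ∃ C ⊆ s, IsClosed C ∧ c ≤ μ C := by
  let := TopologicalSpace.upgradeIsCompletelyMetrizable α
  rw [AnalyticSet] at hs
  rcases hs with rfl | ⟨h, hcont, rfl⟩
  · simp at hc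
  have step : ∀ (k : ℕ) (D : Set (ℕ → ℕ)), ∃ n : ℕ,
      c < μ (h '' D) → c < μ (h '' (D ∩ {x | x k ≤ n})) := by
    intro k D
    by_cases hD : c < μ (h '' D)
    · have hun : h '' D = ⋃ n : ℕ, h '' (D ∩ {x | x k ≤ n}) := by
        rw [← Set.image_iUnion, ← Set.inter_iUnion]
        congr 1
        refine (Set.inter_eq_left.2 fun x _ => ?_).symm
        exact Set.mem_iUnion.2 ⟨x k, le_refl (x k)⟩
      have hmono : Monotone fun n : ℕ => h '' (D ∩ {x | x k ≤ n}) := fun m n hmn =>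
        Set.image_mono (Set.inter_subset_inter_right _ fun x (hx : x k ≤ m) => hx.trans hmn)
      rw [hun, hmono.measure_iUnion, lt_iSup_iff] at hD
      exact hD.imp fun n hn _ => hn
    · exact ⟨0, fun h => absurd h hD⟩
  choose n hn using step
  let D : ℕ → Set (ℕ → ℕ) := fun k => Nat.rec Set.univ (fun k D => D ∩ {x | x k ≤ n k D}) k
  let a : ℕ → ℕ := fun k => n k (D k)
  have hDsucc (k : ℕ) : D (k + 1) = D k ∩ {x | x k ≤ a k} := rfl
  have hDc (k : ℕ) : c < μ (h '' D k) := by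
    induction k with
    | zero => simpa [D] using hc
    | succ k ih => exact hn k (D k) ih
  have hDanti : Antitone D := antitone_nat_of_succ_le fun k => Set.inter_subset_left
  have hDle {k i : ℕ} (hik : i < k) {x : ℕ → ℕ} (hx : x ∈ D k) : x i ≤ a i :=
    (hDanti (Nat.succ_le_of_lt hik) hx).2
  have hcompact (b : ℕ → ℕ) : IsCompact {x : ℕ → ℕ | ∀ i, x i ≤ b i} := by
    have := isCompact_univ_pi (fun i => (Set.finite_Iic (b i)).isCompact)
    convert this using 1
    ext x; simp [Pi.le_def]
  have hCclosed : IsClosed (h '' {x | ∀ i, x i ≤ a i}) := ((hcompact a).image hcont).isClosed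
  refine ⟨_, Set.image_subset_range _ _, hCclosed, ?_⟩
  have hsub : ⋂ k, closure (h '' D k) ⊆ h '' {x | ∀ i, x i ≤ a i} := by
    intro y hy
    rw [Set.mem_iInter] at hy
    have (k : ℕ) : ∃ x ∈ D k, dist y (h x) < 1 / ((k : ℝ) + 1) := by
      obtain ⟨_, ⟨x, hx, rfl⟩, hxy⟩ := Metric.mem_closure_iff.1 (hy k) _ Nat.one_div_pos_of_nat
      exact ⟨x, hx, hxy⟩
    choose x hxD hxy using this
    let b : ℕ → ℕ := fun i => max (a i) ((Finset.range (i + 1)).sup fun k => x k i)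
    have hxb (k : ℕ) : x k ∈ {x : ℕ → ℕ | ∀ i, x i ≤ b i} := by
      intro i
      rcases lt_or_ge i k with hik | hki
      · exact (hDle hik (hxD k)).trans (le_max_left _ _)
      · exact (Finset.le_sup (f := fun k => x k i)
          (Finset.mem_range.2 (Nat.lt_succ_of_le hki))).trans (le_max_right _ _)
    obtain ⟨z, -, σ, hσ, hz⟩ := (hcompact b).tendsto_subseq hxb
    refine ⟨z, fun i => ?_, ?_⟩
    · have hzi : Tendsto (fun k => x (σ k) i) atTop (𝓝 (z i)) := (tendsto_pi_nhds.1 hz) i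
      refine le_of_tendsto hzi ?_
      filter_upwards [eventually_gt_atTop i] with k hk
      exact hDle (hk.trans_le (hσ.id_le k)) (hxD _)
    · have h1 : Tendsto (fun k => h (x (σ k))) atTop (𝓝 (h z)) := (hcont.tendsto z).comp hz
      have h2 : Tendsto (fun k => h (x k)) atTop (𝓝 y) := by
        rw [tendsto_iff_dist_tendsto_zero]
        refine squeeze_zero (fun _ => dist_nonneg) (fun k => ?_)
          tendsto_one_div_add_atTop_nhds_zero_nat
        rw [dist_comm]
        exact (hxy k).le
      exact tendsto_nhds_unique h1 (h2.comp hσ.tendsto_atTop)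
  have hlim := tendsto_measure_iInter_atTop (μ := μ) (s := fun k => closure (h '' D k))
    (fun k => isClosed_closure.measurableSet.nullMeasurableSet)
    (fun i j hij => closure_mono (Set.image_mono (hDanti hij))) ⟨0, measure_ne_top _ _⟩
  exact (ge_of_tendsto' hlim fun k => (hDc k).le.trans (measure_mono subset_closure)).trans
    (measure_mono hsub)

/-- Analytic sets are universally measurable. -/
theorem MeasureTheory.AnalyticSet.nullMeasurableSet {α : Type*}
    [TopologicalSpace α] [PolishSpace α] [MeasurableSpace α] [BorelSpace α]
    (μ : Measure α) [IsFiniteMeasure μ] {s : Set α} (hs : AnalyticSet s) :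
    NullMeasurableSet s μ := by
  rcases eq_or_ne (μ s) 0 with h0 | h0
  · exact NullMeasurableSet.of_null h0
  obtain ⟨c, -, hc, hlim⟩ := exists_seq_strictMono_tendsto' (pos_iff_ne_zero.2 h0)
  choose C hCs hCclosed hCc using fun n => hs.exists_isClosed_subset_le_measure μ (hc n).2
  have hmeas : MeasurableSet (⋃ n, C n) := .iUnion fun n => (hCclosed n).measurableSet
  have hle : μ s ≤ μ (⋃ n, C n) := le_of_tendsto' hlim fun n =>
    (hCc n).trans (measure_mono (Set.subset_iUnion C n))
  exact hmeas.nullMeasurableSet.congr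
    (ae_eq_of_subset_of_measure_ge (Set.iUnion_subset hCs) hle hmeas.nullMeasurableSet
      (measure_ne_top _ _))

/-- A measurable set of a product only depends on countably many measurable sets of the first
factor, encoded by a measurable map to the Baire space. -/
theorem MeasurableSet.exists_preimage_baire {Ω E : Type*} [MeasurableSpace Ω]
    [MeasurableSpace E] {A : Set (Ω × E)} (hA : MeasurableSet A) :
    ∃ φ : Ω → ℕ → ℕ, Measurable φ ∧ ∃ B : Set ((ℕ → ℕ) × E), MeasurableSet B ∧
      A = {p | (φ p.1, p.2) ∈ B} := by
  rw [← generateFrom_prod] at hA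
  induction A, hA using MeasurableSpace.generateFrom_induction with
  | hC A hA =>
    obtain ⟨s, hs, t, ht, rfl⟩ := hA
    refine ⟨fun ω _ => if ω ∈ s then 1 else 0, ?_, {z | z 0 = 1} ×ˢ t, ?_, ?_⟩
    · exact measurable_pi_lambda _ fun _ => measurable_const.ite hs measurable_const
    · exact (measurableSet_eq_fun (measurable_pi_apply 0) measurable_const).prod ht
    · ext p; simp
  | empty => exact ⟨fun _ _ => 0, measurable_const, ∅, .empty, by simp⟩
  | compl A _ ih =>
    obtain ⟨φ, hφ, B, hB, rfl⟩ := ih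
    exact ⟨φ, hφ, Bᶜ, hB.compl, rfl⟩
  | iUnion A _ ih =>
    choose φ hφ B hB hAB using ih
    refine ⟨fun ω k => φ k.unpair.1 ω k.unpair.2, ?_,
      ⋃ n, {p | ((fun k => p.1 (Nat.pair n k)), p.2) ∈ B n}, ?_, ?_⟩
    · exact measurable_pi_lambda _ fun k => (measurable_pi_apply _).comp (hφ _)
    · refine .iUnion fun n => hB n |>.preimage (f := fun p : (ℕ → ℕ) × E =>
        ((fun k => p.1 (Nat.pair n k)), p.2)) ?_
      fun_prop
    · ext p; simp [hAB]

/-- **Measurable projection theorem.** -/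
theorem MeasurableSet.nullMeasurableSet_image_fst {Ω E : Type*} [MeasurableSpace Ω]
    [MeasurableSpace E] [StandardBorelSpace E] (μ : Measure Ω) [IsFiniteMeasure μ]
    {A : Set (Ω × E)} (hA : MeasurableSet A) : NullMeasurableSet {ω | ∃ e, (ω, e) ∈ A} μ := by
  let := upgradeStandardBorel E
  obtain ⟨φ, hφ, B, hB, rfl⟩ := hA.exists_preimage_baire
  have hBa : AnalyticSet (Prod.fst '' B) := hB.analyticSet.image_of_continuous continuous_fst
  have := (hBa.nullMeasurableSet (μ.map φ)).preimage (hφ.measurePreserving μ).quasiMeasurePreserving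
  convert this using 1
  ext ω; simp

/-- If `S` preserves a probability measure and `A` is carried into itself by `S^[m + 1]` up to
sets whose measure tends to zero with `m`, then `A` is almost invariant. -/
theorem MeasureTheory.MeasurePreserving.preimage_ae_eq_of_tendsto {Ω : Type*} [MeasurableSpace Ω]
    {μ : Measure Ω} [IsProbabilityMeasure μ] {S : Ω → Ω} (hS : MeasurePreserving S μ μ)
    {A : Set Ω} (hA : MeasurableSet A) {W : ℕ → Set Ω} (hW : ∀ m, MeasurableSet (W m))
    (hWlim : Tendsto (fun m => μ (W m)) atTop (𝓝 1))
    (hsub : ∀ᵐ ω ∂μ, ∀ m, ω ∈ W m → ω ∈ A → S^[m + 1] ω ∈ A) : S ⁻¹' A =ᵐ[μ] A := by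
  have hmeas (n : ℕ) : MeasurableSet (S^[n] ⁻¹' A) := hA.preimage (hS.iterate n).measurable
  have hle (m : ℕ) : μ (A \ S^[m + 1] ⁻¹' A) ≤ μ (W m)ᶜ := by
    refine measure_mono_ae ?_
    filter_upwards [hsub] with ω hω h
    exact fun hWm => h.2 (hω m hWm h.1)
  have hdiff (n : ℕ) : μ (S^[n] ⁻¹' A \ A) = μ (A \ S^[n] ⁻¹' A) := by
    have h := (hS.iterate n).measure_preimage hA.nullMeasurableSet
    rw [← measure_inter_add_sdiff (S^[n] ⁻¹' A) hA, ← measure_inter_add_sdiff A (hmeas n),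
      Set.inter_comm] at h
    exact (ENNReal.add_right_inj (measure_ne_top _ _)).1 h
  have hsymm (m : ℕ) : μ (symmDiff A (S^[m + 1] ⁻¹' A)) ≤ 2 * μ (W m)ᶜ := by
    rw [symmDiff_def, two_mul]
    refine (measure_union_le _ _).trans (add_le_add (hle m) ?_)
    exact (hdiff (m + 1)).trans_le (hle m)
  have hlim : Tendsto (fun m => 2 * μ (W m)ᶜ) atTop (𝓝 0) := by
    have h : Tendsto (fun m => 2 * (1 - μ (W m))) atTop (𝓝 (2 * (1 - 1))) :=
      ENNReal.Tendsto.const_mul (ENNReal.Tendsto.sub tendsto_const_nhds hWlim (by simp))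
        (by simp)
    simpa [prob_compl_eq_one_sub (hW _)] using h
  have hbound (m : ℕ) : μ (symmDiff (S ⁻¹' A) A) ≤ 2 * μ (W (m + 1))ᶜ + 2 * μ (W m)ᶜ := by
    have h := (hS.iterate (m + 1)).measure_preimage
      ((hA.preimage hS.measurable).symmDiff hA).nullMeasurableSet
    rw [← h]
    have hpre : S^[m + 1] ⁻¹' symmDiff (S ⁻¹' A) A
        = symmDiff (S^[m + 1 + 1] ⁻¹' A) (S^[m + 1] ⁻¹' A) := by
      rw [Function.iterate_succ' S (m + 1)]; rfl
    rw [hpre]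
    refine (measure_symmDiff_le _ A _).trans (add_le_add ?_ (hsymm m))
    rw [symmDiff_comm]
    exact hsymm (m + 1)
  rw [← measure_symmDiff_eq_zero_iff, ← nonpos_iff_eq_zero]
  have hlim' := ((tendsto_add_atTop_iff_nat 1).2 hlim).add hlim
  rw [add_zero] at hlim'
  exact ge_of_tendsto' hlim' hbound

section Pullback

variable {Ω V : Type*} {S : Ω → Ω} {f : Ω → V → V} {X Y : Ω → Set V}

theorem backComp_succ_apply (m : ℕ) (ω : Ω) (x : V) :
    backComp S f (m + 1) ω x = f (S ω) (backComp S f m (S ω) x) := by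
  induction m generalizing x with
  | zero => rfl
  | succ m ih => exact ih _

theorem backComp_add_apply (m k : ℕ) (ω : Ω) (x : V) :
    backComp S f (m + 1 + k) ω x = backComp S f m ω (backComp S f k (S^[m + 1] ω) x) := by
  induction k generalizing x with
  | zero =>
    change backComp S f m ω _ = backComp S f m ω (f (S (S^[m + 1] ω)) x)
    rw [← Function.iterate_succ_apply' S]
  | succ k ih =>
    change backComp S f (m + 1 + k) ω _ = backComp S f m ω
      (backComp S f k (S^[m + 1] ω) (f (S^[k + 2] (S^[m + 1] ω)) x))
    rw [ih, ← Function.iterate_add_apply, show k + 2 + (m + 1) = m + 1 + k + 2 by omega]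
    rfl

variable (S f X) in
/-- The set `X^{(m)}(ω)` of all values at `ω` of the `m`-th backward composition. -/
def backRange (m : ℕ) (ω : Ω) : Set V := backComp S f m ω '' X (S^[m + 1] ω)

variable (S f X) in
/-- The pullback attractor `⋂ₘ X^{(m)}(ω)`. -/
def pullbackAttractor (ω : Ω) : Set V := ⋂ m, backRange S f X m ω

theorem pullbackAttractor_subset (m : ℕ) (ω : Ω) :
    pullbackAttractor S f X ω ⊆ backRange S f X m ω := Set.iInter_subset _ m

theorem antitone_backRange (hf : ∀ ω, ∀ x ∈ X (S ω), f (S ω) x ∈ X ω) (ω : Ω) :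
    Antitone fun m => backRange S f X m ω := by
  refine antitone_nat_of_succ_le fun m => ?_
  rintro _ ⟨x, hx, rfl⟩
  rw [Function.iterate_succ_apply'] at hx
  have h := hf _ _ hx
  rw [← Function.iterate_succ_apply' S (m + 1)] at h
  exact ⟨_, h, rfl⟩

theorem backRange_add (m k : ℕ) (ω : Ω) :
    backRange S f X (m + 1 + k) ω
      = backComp S f m ω '' backRange S f X k (S^[m + 1] ω) := by
  rw [backRange, backRange, Set.image_image, ← Function.iterate_add_apply,
    show k + 1 + (m + 1) = m + 1 + k + 1 by omega]
  exact Set.image_congr fun x _ => backComp_add_apply m k ω x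

theorem apply_mem_pullbackAttractor (hf : ∀ ω, ∀ x ∈ X (S ω), f (S ω) x ∈ X ω) {ω : Ω} {x : V}
    (hx : x ∈ pullbackAttractor S f X (S ω)) : f (S ω) x ∈ pullbackAttractor S f X ω := by
  refine Set.mem_iInter.2 fun m => antitone_backRange hf ω (Nat.le_succ m) ?_
  obtain ⟨z, hz, rfl⟩ := pullbackAttractor_subset m _ hx
  exact ⟨z, hz, backComp_succ_apply m ω z⟩

variable [∀ ω, MetricSpace (Y ω)]

variable (S f X Y) in
/-- The `m`-th backward composition at `ω` has compact range inside `Y ω` and strictly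
decreases distances between points of `Y`. -/
structure IsContractingAt (m : ℕ) (ω : Ω) : Prop where
  subset : backRange S f X m ω ⊆ Y ω
  isCompact : IsCompact ((↑) ⁻¹' backRange S f X m ω : Set (Y ω))
  dist_lt : ∀ (x x' : Y (S^[m + 1] ω)) (y y' : Y ω), backComp S f m ω x = y →
    backComp S f m ω x' = y' → x ≠ x' → dist y y' < dist x x'

theorem pullbackAttractor_nonempty (hf : ∀ ω, ∀ x ∈ X (S ω), f (S ω) x ∈ X ω)
    (hX : ∀ ω, (X ω).Nonempty) {ω : Ω}
    (hω : ∃ M, ∀ m, M ≤ m → IsContractingAt S f X Y m ω) :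
    (pullbackAttractor S f X ω).Nonempty := by
  obtain ⟨M, hM⟩ := hω
  obtain ⟨y, hy⟩ := IsCompact.nonempty_iInter_of_sequence_nonempty_isCompact_isClosed
    (fun k => ((↑) ⁻¹' backRange S f X (M + k) ω : Set (Y ω)))
    (fun k => Set.preimage_mono (antitone_backRange hf ω (Nat.le_succ _)))
    (fun k => by
      obtain ⟨y, hy⟩ : (backRange S f X (M + k) ω).Nonempty := (hX _).image _
      exact ⟨⟨y, (hM _ le_self_add).subset hy⟩, hy⟩)
    (hM _ le_self_add).isCompact (fun k => (hM _ le_self_add).isCompact.isClosed)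
  refine ⟨y, Set.mem_iInter.2 fun m => antitone_backRange hf ω (Nat.le_add_left m M) ?_⟩
  exact Set.mem_iInter.1 hy m

theorem isCompact_pullbackAttractor {ω : Ω} (hf : ∀ ω, ∀ x ∈ X (S ω), f (S ω) x ∈ X ω)
    (hω : ∃ M, ∀ m, M ≤ m → IsContractingAt S f X Y m ω) :
    IsCompact ((↑) ⁻¹' pullbackAttractor S f X ω : Set (Y ω)) := by
  obtain ⟨M, hM⟩ := hω
  have : ((↑) ⁻¹' pullbackAttractor S f X ω : Set (Y ω))
      = ⋂ k, (↑) ⁻¹' backRange S f X (M + k) ω := by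
    ext y
    simp only [pullbackAttractor, Set.mem_preimage, Set.mem_iInter]
    exact ⟨fun h k => h _, fun h m => antitone_backRange hf ω (Nat.le_add_left m M) (h m)⟩
  rw [this]
  exact (hM _ le_self_add).isCompact.of_isClosed_subset
    (isClosed_iInter fun k => (hM _ le_self_add).isCompact.isClosed) (Set.iInter_subset _ 0)

/-- Every point of the attractor at `ω` is the image of a point of the attractor in the past. -/
theorem exists_backComp_eq_of_mem_pullbackAttractor
    (hf : ∀ ω, ∀ x ∈ X (S ω), f (S ω) x ∈ X ω) (hYX : ∀ ω, Y ω ⊆ X ω) {m : ℕ} {ω : Ω}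
    (hm : IsContractingAt S f X Y m ω)
    (hω : ∃ M, ∀ k, M ≤ k → IsContractingAt S f X Y k (S^[m + 1] ω))
    {y : V} (hy : y ∈ pullbackAttractor S f X ω) :
    ∃ x : Y (S^[m + 1] ω), ↑x ∈ pullbackAttractor S f X (S^[m + 1] ω) ∧
      backComp S f m ω x = y := by
  obtain ⟨M, hM⟩ := hω
  let B : Y (S^[m + 1] ω) → Y ω := fun x =>
    ⟨backComp S f m ω x, hm.subset ⟨x, hYX _ x.2, rfl⟩⟩
  have hB : Continuous B := by
    refine (LipschitzWith.mk_one fun x x' => ?_).continuous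
    rcases eq_or_ne x x' with rfl | hne
    · simp only [dist_self, le_refl]
    · exact (hm.dist_lt x x' _ _ rfl rfl hne).le
  let y' : Y ω := ⟨y, hm.subset (pullbackAttractor_subset m ω hy)⟩
  let D : ℕ → Set (Y (S^[m + 1] ω)) := fun k =>
    (↑) ⁻¹' backRange S f X (M + k) (S^[m + 1] ω) ∩ B ⁻¹' {y'}
  have hD (k : ℕ) : IsCompact (D k) :=
    (hM _ le_self_add).isCompact.inter_right (isClosed_singleton.preimage hB)
  obtain ⟨x, hx⟩ := IsCompact.nonempty_iInter_of_sequence_nonempty_isCompact_isClosed D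
    (fun k => Set.inter_subset_inter_left _
      (Set.preimage_mono (antitone_backRange hf _ (Nat.le_succ _))))
    (fun k => by
      have h := pullbackAttractor_subset (m + 1 + (M + k)) ω hy
      rw [backRange_add] at h
      obtain ⟨x, hx, hxy⟩ := h
      exact ⟨⟨x, (hM _ le_self_add).subset hx⟩, hx, Subtype.ext hxy⟩)
    (hD 0) (fun k => (hD k).isClosed)
  rw [Set.mem_iInter] at hx
  refine ⟨x, Set.mem_iInter.2 fun k => ?_, congrArg Subtype.val (hx 0).2⟩
  exact antitone_backRange hf _ (Nat.le_add_left k M) (hx k).1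

variable (S f X Y) in
/-- The set of `ω` for which the attractor has diameter larger than `q`. -/
def attractorDiamGT (q : ℝ) : Set Ω :=
  {ω | ∃ y y' : Y ω, ↑y ∈ pullbackAttractor S f X ω ∧ ↑y' ∈ pullbackAttractor S f X ω ∧
    q < dist y y'}

theorem iterate_mem_attractorDiamGT (hf : ∀ ω, ∀ x ∈ X (S ω), f (S ω) x ∈ X ω)
    (hYX : ∀ ω, Y ω ⊆ X ω) {m : ℕ} {ω : Ω} (hm : IsContractingAt S f X Y m ω)
    (hω : ∃ M, ∀ k, M ≤ k → IsContractingAt S f X Y k (S^[m + 1] ω)) {q : ℝ} (hq : 0 ≤ q)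
    (h : ω ∈ attractorDiamGT S f X Y q) : S^[m + 1] ω ∈ attractorDiamGT S f X Y q := by
  obtain ⟨y, y', hy, hy', hyy⟩ := h
  obtain ⟨x, hx, hxy⟩ := exists_backComp_eq_of_mem_pullbackAttractor hf hYX hm hω hy
  obtain ⟨x', hx', hxy'⟩ := exists_backComp_eq_of_mem_pullbackAttractor hf hYX hm hω hy'
  refine ⟨x, x', hx, hx', hyy.trans (hm.dist_lt x x' y y' hxy hxy' ?_)⟩
  rintro rfl
  exact (dist_pos.1 (hq.trans_lt hyy)) (Subtype.ext (hxy.symm.trans hxy'))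

/-- If the attractor at `ω` is not a singleton, its diameter was strictly larger in the past. -/
theorem exists_rat_separating_attractorDiam (hf : ∀ ω, ∀ x ∈ X (S ω), f (S ω) x ∈ X ω)
    (hYX : ∀ ω, Y ω ⊆ X ω) {m : ℕ} {ω : Ω} (hm : IsContractingAt S f X Y m ω)
    (hω : ∃ M, ∀ k, M ≤ k → IsContractingAt S f X Y k ω)
    (hω' : ∃ M, ∀ k, M ≤ k → IsContractingAt S f X Y k (S^[m + 1] ω))
    (h : ¬ (pullbackAttractor S f X ω).Subsingleton) :
    ∃ q : ℚ, (0 : ℝ) ≤ q ∧ ω ∉ attractorDiamGT S f X Y q ∧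
      S^[m + 1] ω ∈ attractorDiamGT S f X Y q := by
  obtain ⟨a, ha, b, hb, hab⟩ := Set.not_subsingleton_iff.1 h
  have hY := (pullbackAttractor_subset m ω).trans hm.subset
  have hK := isCompact_pullbackAttractor hf hω
  obtain ⟨⟨y, y'⟩, ⟨hy, hy'⟩, hmax⟩ := (hK.prod hK).exists_isMaxOn
    ⟨(⟨a, hY ha⟩, ⟨b, hY hb⟩), ha, hb⟩ continuous_dist.continuousOn
  have hpos : 0 < dist y y' := by
    have h1 : dist (⟨a, hY ha⟩ : Y ω) ⟨b, hY hb⟩ ≤ dist y y' :=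
      hmax (show ((⟨a, hY ha⟩, ⟨b, hY hb⟩) : Y ω × Y ω) ∈ _ from ⟨ha, hb⟩)
    refine (dist_pos.2 fun h => hab ?_).trans_le h1
    exact congrArg Subtype.val h
  obtain ⟨x, hx, hxy⟩ := exists_backComp_eq_of_mem_pullbackAttractor hf hYX hm hω' hy
  obtain ⟨x', hx', hxy'⟩ := exists_backComp_eq_of_mem_pullbackAttractor hf hYX hm hω' hy'
  have hlt : dist y y' < dist x x' := by
    refine hm.dist_lt x x' y y' hxy hxy' ?_
    rintro rfl
    exact dist_pos.1 hpos (Subtype.ext (hxy.symm.trans hxy'))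
  obtain ⟨q, hq, hq'⟩ := exists_rat_btwn hlt
  refine ⟨q, (hpos.trans hq).le, ?_, x, x', hx, hx', hq'⟩
  rintro ⟨z, z', hz, hz', hzz⟩
  have : dist z z' ≤ dist y y' := hmax (show ((z, z') : Y ω × Y ω) ∈ _ from ⟨hz, hz'⟩)
  linarith

theorem exists_backRange_dist_lt (hf : ∀ ω, ∀ x ∈ X (S ω), f (S ω) x ∈ X ω) {ω : Ω}
    (hω : ∃ M, ∀ m, M ≤ m → IsContractingAt S f X Y m ω) {ξ : Y ω}
    (hξ : pullbackAttractor S f X ω = {↑ξ}) {ε : ℝ} (hε : 0 < ε) :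
    ∃ M, ∀ m, M ≤ m → ∀ y : Y ω, ↑y ∈ backRange S f X m ω → dist ξ y < ε := by
  obtain ⟨M, hM⟩ := hω
  let C : ℕ → Set (Y ω) := fun k => (↑) ⁻¹' backRange S f X (M + k) ω
  have hanti : Antitone C := fun i j hij =>
    Set.preimage_mono (antitone_backRange hf ω (Nat.add_le_add_left hij M))
  obtain ⟨k, hk⟩ := exists_subset_nhds_of_isCompact (V := C) (U := Metric.ball ξ ε)
    hanti.directed_ge (fun k => (hM _ le_self_add).isCompact) (fun y hy => by
      have hyK : (y : V) ∈ pullbackAttractor S f X ω := Set.mem_iInter.2 fun m =>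
        antitone_backRange hf ω (Nat.le_add_left m M) (Set.mem_iInter.1 hy m)
      rw [hξ] at hyK
      rw [Subtype.ext hyK]
      exact Metric.ball_mem_nhds _ hε)
  refine ⟨M + k, fun m hm y hy => ?_⟩
  rw [dist_comm]
  exact hk (antitone_backRange hf ω hm hy)

/-- Almost surely the pullback attractor has at most one point. -/
theorem ae_subsingleton_pullbackAttractor [MeasurableSpace Ω] {μ : Measure Ω}
    [IsProbabilityMeasure μ] (hS : MeasurePreserving S μ μ)
    (hf : ∀ ω, ∀ x ∈ X (S ω), f (S ω) x ∈ X ω) (hYX : ∀ ω, Y ω ⊆ X ω)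
    {W : ℕ → Set Ω} (hW : ∀ m, MeasurableSet (W m))
    (hWlim : Tendsto (fun m => μ (W m)) atTop (𝓝 1))
    (hWc : ∀ m, ∀ ω ∈ W m, IsContractingAt S f X Y m ω)
    (hgood : ∀ᵐ ω ∂μ, ∃ M, ∀ m, M ≤ m → ω ∈ W m)
    (hmeas : ∀ q : ℝ, 0 ≤ q → MeasurableSet (attractorDiamGT S f X Y q)) :
    ∀ᵐ ω ∂μ, (pullbackAttractor S f X ω).Subsingleton := by
  have hgood' : ∀ᵐ ω ∂μ, ∃ M, ∀ m, M ≤ m → IsContractingAt S f X Y m ω :=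
    hgood.mono fun ω h => h.imp fun M hM m hm => hWc m ω (hM m hm)
  have hgoodS : ∀ᵐ ω ∂μ, ∀ n, ∃ M, ∀ m, M ≤ m → IsContractingAt S f X Y m (S^[n] ω) :=
    ae_all_iff.2 fun n => (hS.iterate n).quasiMeasurePreserving.ae hgood'
  have hinv : ∀ᵐ ω ∂μ, ∀ q : ℚ, (0 : ℝ) ≤ q → ∀ n,
      (S^[n] ω ∈ attractorDiamGT S f X Y q ↔ ω ∈ attractorDiamGT S f X Y q) := by
    refine ae_all_iff.2 fun q => ?_
    by_cases hq : (0 : ℝ) ≤ q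
    · have h := hS.preimage_ae_eq_of_tendsto (hmeas q hq) hW hWlim
        (hgoodS.mono fun ω hω m hWm hA =>
          iterate_mem_attractorDiamGT hf hYX (hWc m ω hWm) (hω _) hq hA)
      have h' (n : ℕ) := hS.quasiMeasurePreserving.preimage_iterate_ae_eq n h
      filter_upwards [ae_all_iff.2 fun n => (h' n).mem_iff] with ω hω _ n using hω n
    · exact .of_forall fun ω h => absurd h hq
  filter_upwards [hgoodS, hinv] with ω hω hωinv
  by_contra hne
  obtain ⟨M, hM⟩ := hω 0
  obtain ⟨q, hq, hnot, hmem⟩ := exists_rat_separating_attractorDiam hf hYX (hM M le_rfl)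
    (hω 0) (hω (M + 1)) hne
  exact hnot ((hωinv q hq _).1 hmem)

end Pullback


section Measurability

variable {Ω V : Type*} [MeasurableSpace Ω] [MeasurableSpace V] {S : Ω → Ω} {f : Ω → V → V}
  {X Y : Ω → Set V}

theorem exists_measurable_eq_backComp (hS : Measurable S)
    (hf : ∀ ω, ∀ x ∈ X (S ω), f (S ω) x ∈ X ω) {F : Ω × V → V} (hF : Measurable F)
    (hFf : ∀ ω, ∀ x ∈ X (S ω), F (ω, x) = f (S ω) x) (m : ℕ) :
    ∃ b : Ω × V → V, Measurable b ∧ ∀ ω, ∀ x ∈ X (S^[m + 1] ω), b (ω, x) = backComp S f m ω x := by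
  induction m with
  | zero => exact ⟨F, hF, hFf⟩
  | succ m ih =>
    obtain ⟨b, hb, hbf⟩ := ih
    refine ⟨fun p => b (p.1, F (S^[m + 1] p.1, p.2)), ?_, fun ω x hx => ?_⟩
    · exact hb.comp (measurable_fst.prodMk
        (hF.comp (((hS.iterate (m + 1)).comp measurable_fst).prodMk measurable_snd)))
    · rw [Function.iterate_succ_apply'] at hx
      have h := hf _ _ hx
      simp only [hFf _ _ hx, hbf _ _ h]
      rw [← Function.iterate_succ_apply' S]
      rfl

theorem measurableSet_backComp_eq [StandardBorelSpace V] (hS : Measurable S)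
    (hX : MeasurableSet {p : Ω × V | p.2 ∈ X p.1})
    (hf : ∀ ω, ∀ x ∈ X (S ω), f (S ω) x ∈ X ω) {F : Ω × V → V} (hF : Measurable F)
    (hFf : ∀ ω, ∀ x ∈ X (S ω), F (ω, x) = f (S ω) x) (m : ℕ) :
    MeasurableSet {p : Ω × V × V |
      p.2.1 ∈ X (S^[m + 1] p.1) ∧ backComp S f m p.1 p.2.1 = p.2.2} := by
  let := upgradeStandardBorel V
  obtain ⟨b, hb, hbf⟩ := exists_measurable_eq_backComp hS hf hF hFf m
  have h1 : MeasurableSet {p : Ω × V × V | p.2.1 ∈ X (S^[m + 1] p.1)} :=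
    hX.preimage (f := fun p : Ω × V × V => (S^[m + 1] p.1, p.2.1))
      (((hS.iterate (m + 1)).comp measurable_fst).prodMk (measurable_fst.comp measurable_snd))
  have h2 : MeasurableSet {p : Ω × V × V | b (p.1, p.2.1) = p.2.2} :=
    measurableSet_eq_fun (hb.comp (by fun_prop)) (by fun_prop)
  convert h1.inter h2 using 1
  ext p
  exact and_congr_right fun h => by rw [Set.mem_ofPred_eq, hbf _ _ h]

theorem nullMeasurableSet_exists_mem_pullbackAttractor [StandardBorelSpace V] (hS : Measurable S)
    (hX : MeasurableSet {p : Ω × V | p.2 ∈ X p.1})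
    (hf : ∀ ω, ∀ x ∈ X (S ω), f (S ω) x ∈ X ω) {F : Ω × V → V} (hF : Measurable F)
    (hFf : ∀ ω, ∀ x ∈ X (S ω), F (ω, x) = f (S ω) x) (μ : Measure Ω) [IsFiniteMeasure μ]
    {A : Set (Ω × V × V)} (hA : MeasurableSet A) :
    NullMeasurableSet {ω | ∃ y y', y ∈ pullbackAttractor S f X ω ∧
      y' ∈ pullbackAttractor S f X ω ∧ (ω, y, y') ∈ A} μ := by
  let G (m : ℕ) := {p : Ω × V × V |
      p.2.1 ∈ X (S^[m + 1] p.1) ∧ backComp S f m p.1 p.2.1 = p.2.2}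
  have hG (m : ℕ) : MeasurableSet (G m) := measurableSet_backComp_eq hS hX hf hF hFf m
  have hmeas : MeasurableSet ({p : Ω × (V × V) × (ℕ → V) × (ℕ → V) | (p.1, p.2.1) ∈ A} ∩
      ⋂ m, {p | (p.1, p.2.2.1 m, p.2.1.1) ∈ G m ∧ (p.1, p.2.2.2 m, p.2.1.2) ∈ G m}) := by
    refine (hA.preimage (by fun_prop)).inter (.iInter fun m => ?_)
    exact ((hG m).preimage (f := fun p : Ω × (V × V) × (ℕ → V) × (ℕ → V) =>
      (p.1, p.2.2.1 m, p.2.1.1)) (by fun_prop)).inter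
      ((hG m).preimage (f := fun p : Ω × (V × V) × (ℕ → V) × (ℕ → V) =>
      (p.1, p.2.2.2 m, p.2.1.2)) (by fun_prop))
  convert hmeas.nullMeasurableSet_image_fst μ using 1
  ext ω
  constructor
  · rintro ⟨y, y', hy, hy', h⟩
    choose x hx using Set.mem_iInter.1 hy
    choose x' hx' using Set.mem_iInter.1 hy'
    exact ⟨((y, y'), x, x'), h, Set.mem_iInter.2 fun m => ⟨hx m, hx' m⟩⟩
  · rintro ⟨⟨⟨y, y'⟩, x, x'⟩, h, hG⟩
    rw [Set.mem_iInter] at hG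
    exact ⟨y, y', Set.mem_iInter.2 fun m => ⟨x m, (hG m).1⟩,
      Set.mem_iInter.2 fun m => ⟨x' m, (hG m).2⟩, h⟩

/-- Existence of a stochastic fixed point, as a pullback limit along the shift `S`. -/
theorem exists_stochastic_fixed_point_of_pullback [StandardBorelSpace V] {μ : Measure Ω}
    [IsProbabilityMeasure μ] [μ.IsComplete] (hS : MeasurePreserving S μ μ)
    (hX : MeasurableSet {p : Ω × V | p.2 ∈ X p.1}) (hXne : ∀ ω, (X ω).Nonempty)
    (hf : ∀ ω, ∀ x ∈ X (S ω), f (S ω) x ∈ X ω) {F : Ω × V → V} (hF : Measurable F)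
    (hFf : ∀ ω, ∀ x ∈ X (S ω), F (ω, x) = f (S ω) x)
    (hYX : ∀ ω, Y ω ⊆ X ω) (hYne : ∀ ω, (Y ω).Nonempty)
    (hY : MeasurableSet {p : Ω × V | p.2 ∈ Y p.1}) [∀ ω, MetricSpace (Y ω)]
    {ρ : Ω × V × V → ℝ≥0∞} (hρ : Measurable ρ)
    (hρdist : ∀ ω (y y' : Y ω), ρ (ω, y, y') = ENNReal.ofReal (dist y y'))
    {W : ℕ → Set Ω} (hW : ∀ m, MeasurableSet (W m))
    (hWlim : Tendsto (fun m => μ (W m)) atTop (𝓝 1))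
    (hWc : ∀ m, ∀ ω ∈ W m, IsContractingAt S f X Y m ω)
    (hgood : ∀ᵐ ω ∂μ, ∃ M, ∀ m, M ≤ m → ω ∈ W m) :
    ∃ ξ : ∀ ω, Y ω, Measurable (fun ω => (ξ ω : V)) ∧
      (∀ᵐ ω ∂μ, (ξ ω : V) = f (S ω) (ξ (S ω))) ∧
      ∀ᵐ ω ∂μ, ∀ ε : ℝ, 0 < ε → ∃ M, ∀ m, M ≤ m →
        ∀ y : Y ω, ↑y ∈ backRange S f X m ω → dist (ξ ω) y < ε := by
  have hgood' : ∀ᵐ ω ∂μ, ∃ M, ∀ m, M ≤ m → IsContractingAt S f X Y m ω :=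
    hgood.mono fun ω h => h.imp fun M hM m hm => hWc m ω (hM m hm)
  have hmeas (q : ℝ) (hq : 0 ≤ q) : MeasurableSet (attractorDiamGT S f X Y q) := by
    refine NullMeasurableSet.measurable_of_complete (μ := μ) ?_
    have hA : MeasurableSet {p : Ω × V × V | p.2.1 ∈ Y p.1 ∧ p.2.2 ∈ Y p.1 ∧
        ENNReal.ofReal q < ρ p} :=
      (hY.preimage (f := fun p : Ω × V × V => (p.1, p.2.1)) (by fun_prop)).inter
        ((hY.preimage (f := fun p : Ω × V × V => (p.1, p.2.2)) (by fun_prop)).inter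
          (measurableSet_lt measurable_const hρ))
    convert nullMeasurableSet_exists_mem_pullbackAttractor hS.measurable hX hf hF hFf μ hA using 1
    ext ω
    constructor
    · rintro ⟨y, y', hy, hy', h⟩
      refine ⟨y, y', hy, hy', y.2, y'.2, ?_⟩
      rw [hρdist]
      exact (ENNReal.ofReal_lt_ofReal_iff_of_nonneg hq).2 h
    · rintro ⟨y, y', hy, hy', hyY, hyY', h⟩
      refine ⟨⟨y, hyY⟩, ⟨y', hyY'⟩, hy, hy', ?_⟩
      rw [hρdist ω ⟨y, hyY⟩ ⟨y', hyY'⟩] at h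
      exact (ENNReal.ofReal_lt_ofReal_iff_of_nonneg hq).1 h
  have hsub := ae_subsingleton_pullbackAttractor hS hf hYX hW hWlim hWc hgood hmeas
  have hex (ω : Ω) : ∃ y : Y ω, (∃ z : Y ω, pullbackAttractor S f X ω = {↑z}) →
      pullbackAttractor S f X ω = {↑y} := by
    by_cases h : ∃ z : Y ω, pullbackAttractor S f X ω = {↑z}
    · exact h.imp fun z hz _ => hz
    · exact ⟨⟨_, (hYne ω).some_mem⟩, fun h' => absurd h' h⟩
  choose ξ hξ using hex
  have hξK : ∀ᵐ ω ∂μ, pullbackAttractor S f X ω = {↑(ξ ω)} := by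
    filter_upwards [hsub, hgood'] with ω hω hωgood
    refine hξ ω ?_
    obtain ⟨y, hy⟩ := pullbackAttractor_nonempty hf hXne hωgood
    obtain ⟨M, hM⟩ := hωgood
    exact ⟨⟨y, (hM M le_rfl).subset (pullbackAttractor_subset M ω hy)⟩,
      hω.eq_singleton_of_mem hy⟩
  refine ⟨ξ, fun s hs => ?_, ?_, ?_⟩
  · have hA : MeasurableSet {p : Ω × V × V | p.2.1 ∈ s} := hs.preimage (by fun_prop)
    refine NullMeasurableSet.measurable_of_complete (μ := μ)
      ((nullMeasurableSet_exists_mem_pullbackAttractor hS.measurable hX hf hF hFf μ hA).congr ?_)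
    filter_upwards [hξK] with ω hω
    refine propext ⟨?_, fun h => ?_⟩
    · rintro ⟨y, -, hy, -, hys⟩
      rw [hω, Set.mem_singleton_iff] at hy
      exact (congrArg (· ∈ s) hy).mp hys
    · exact ⟨ξ ω, ξ ω, hω ▸ rfl, hω ▸ rfl, h⟩
  · filter_upwards [hξK, hS.quasiMeasurePreserving.ae hξK] with ω hω hωS
    have h : f (S ω) (ξ (S ω)) ∈ pullbackAttractor S f X ω :=
      apply_mem_pullbackAttractor hf (hωS ▸ rfl)
    rw [hω] at h
    exact h.symm
  · filter_upwards [hξK, hgood'] with ω hω hωgood ε hε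
    exact exists_backRange_dist_lt hf hωgood hω hε

end Measurability

/-- **Theorem 3(i): stochastic fixed-point principle, existence.** Under (A1)–(A3) there
is an `ℱ₀`-measurable `ξ` with `ξ(ω) ∈ Y(ω)`, solving `ξ(Tω) = f(ω, ξ(ω))` a.s., and the
backward iterates `f₀(ω) … f₋ₘ(ω)(x)` converge to `ξ(ω)` in the metric `ρ(ω, ·, ·)`,
uniformly in `x ∈ X₋ₘ₋₁(ω)`, almost surely (along `m ≥ m(ω)`). -/
theorem stochastic_fixed_point_existence
    {Ω : Type} [inst : MeasurableSpace Ω] {V : Type} [MeasurableSpace V]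
    [StandardBorelSpace V]
    (P : Measure Ω) [IsProbabilityMeasure P] (hPcomplete : P.IsComplete)
    -- `T` is an automorphism of the probability space
    (T : Ω ≃ Ω) (hT : Measurable T) (hTinv : Measurable T.symm)
    (hTP : MeasurePreserving T P P)
    -- the filtration `(ℱ_t)`, invariant under `T` and containing the null sets
    (F : ℤ → MeasurableSpace Ω) (hFle : ∀ t, F t ≤ inst) (hFmono : Monotone F)
    (hFshift : ∀ t, F (t + 1) = (F t).comap T)
    (hFnull : ∀ t, ∀ N : Set Ω, P N = 0 → MeasurableSet[F t] N)
    -- the random set `X(ω)`, nonempty, with `ℱ₀ × 𝒱`-measurable graph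
    (X : Ω → Set V) (hXne : ∀ ω, (X ω).Nonempty)
    (hXgraph : MeasurableSet[(F 0).prod (inferInstance : MeasurableSpace V)]
      {p : Ω × V | p.2 ∈ X p.1})
    -- `f(ω, ·)` maps `X(ω)` into `X(Tω)`
    (f : Ω → V → V) (hfmaps : ∀ ω, ∀ x ∈ X ω, f ω x ∈ X (T ω))
    -- (A1): the extension `f̄` (with value the adjoined point `∞` off the graph)
    -- is `ℱ₁ × 𝒱`-measurable
    (hA1 : @Measurable (Ω × V) (V ⊕ Unit) ((F 1).prod inferInstance) inferInstance
      (fun p => if p.2 ∈ X p.1 then Sum.inl (f p.1 p.2) else Sum.inr ()))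
    -- the random set `Y(ω) ⊆ X(ω)` with its separable metric `ρ(ω, ·, ·)`
    (Y : Ω → Set V) (hYsub : ∀ ω, Y ω ⊆ X ω) (hYne : ∀ ω, (Y ω).Nonempty)
    (ρ : Ω → V → V → ℝ)
    (hρmetric : ∀ ω, ∀ x ∈ Y ω, ∀ y ∈ Y ω,
      0 ≤ ρ ω x y ∧ (ρ ω x y = 0 ↔ x = y) ∧ ρ ω x y = ρ ω y x)
    (hρtriangle : ∀ ω, ∀ x ∈ Y ω, ∀ y ∈ Y ω, ∀ z ∈ Y ω, ρ ω x z ≤ ρ ω x y + ρ ω y z)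
    (hρsep : ∀ ω, ∃ s : Set V, s.Countable ∧ s ⊆ Y ω ∧
      ∀ x ∈ Y ω, ∀ ε : ℝ, 0 < ε → ∃ z ∈ s, ρ ω x z < ε)
    -- (A2)(a): the graph of `Y` is `ℱ₀ × 𝒱`-measurable
    (hA2a : MeasurableSet[(F 0).prod (inferInstance : MeasurableSpace V)]
      {p : Ω × V | p.2 ∈ Y p.1})
    -- (A2)(b): the extension `ρ̄` (equal to `+∞` off `Y(ω) × Y(ω)`) is
    -- `ℱ₀ × 𝒱 × 𝒱`-measurable
    (hA2b : @Measurable (Ω × V × V) ℝ≥0∞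
      ((F 0).prod ((inferInstance : MeasurableSpace V).prod inferInstance)) inferInstance
      (fun p => if p.2.1 ∈ Y p.1 ∧ p.2.2 ∈ Y p.1
        then ENNReal.ofReal (ρ p.1 p.2.1 p.2.2) else ⊤))
    -- (A2)(c): on `Y(ω)` the Borel structure of the metric `ρ(ω, ·, ·)` (generated by
    -- its open balls) coincides with the structure induced by `𝒱`
    (hA2c : ∀ ω, MeasurableSpace.comap (fun y : (Y ω) => (y : V))
        (MeasurableSpace.generateFrom
          {s : Set V | ∃ x ∈ Y ω, ∃ ε : ℝ, 0 < ε ∧ s = {y | y ∈ Y ω ∧ ρ ω x y < ε}})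
      = MeasurableSpace.comap (fun y : (Y ω) => (y : V))
          (inferInstance : MeasurableSpace V))
    -- (A2)(d): `f(ω, ·)` maps `Y(ω)` into `Y(Tω)` continuously for the metrics
    (hA2d : ∀ ω, ∀ x ∈ Y ω, f ω x ∈ Y (T ω))
    (hA2dcont : ∀ ω, ∀ x ∈ Y ω, ∀ ε : ℝ, 0 < ε → ∃ δ : ℝ, 0 < δ ∧
      ∀ y ∈ Y ω, ρ ω x y < δ → ρ (T ω) (f ω x) (f ω y) < ε)
    -- (A3): the `ℱ₀`-measurable sets `Ω₀ ⊆ Ω₁ ⊆ …` with `P(Ω_m) → 1`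
    (Ωs : ℕ → Set Ω) (hΩmeas : ∀ m, MeasurableSet[F 0] (Ωs m)) (hΩmono : Monotone Ωs)
    (hΩP : Tendsto (fun m => P (Ωs m)) atTop (nhds 1))
    -- (A3)(a): for `ω ∈ Ω_m`, `X^{(m)}(ω) = f^{(m)}(ω, X₋ₘ₋₁(ω))` lies in `Y(ω)` and is
    -- compact in the metric `ρ(ω, ·, ·)` (formulated via sequential compactness)
    (hA3a : ∀ m, ∀ ω ∈ Ωs m,
      backComp (⇑T.symm) f m ω '' X ((⇑T.symm)^[m + 1] ω) ⊆ Y ω ∧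
      ∀ u : ℕ → V, (∀ k, u k ∈ backComp (⇑T.symm) f m ω '' X ((⇑T.symm)^[m + 1] ω)) →
        ∃ z ∈ backComp (⇑T.symm) f m ω '' X ((⇑T.symm)^[m + 1] ω),
          ∃ σ : ℕ → ℕ, StrictMono σ ∧ Tendsto (fun k => ρ ω z (u (σ k))) atTop (nhds 0))
    -- (A3)(b): on `Ω_m` the map `f^{(m)}(ω, ·)` is strictly non-expansive
    (hA3b : ∀ m, ∀ ω ∈ Ωs m, ∀ x ∈ Y ((⇑T.symm)^[m + 1] ω), ∀ y ∈ Y ((⇑T.symm)^[m + 1] ω),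
      x ≠ y → ρ ω (backComp (⇑T.symm) f m ω x) (backComp (⇑T.symm) f m ω y)
        < ρ ((⇑T.symm)^[m + 1] ω) x y)
    -- the `ℱ₀`-measurable function `m(ω)` with `ω ∈ Ω_m` for all `m ≥ m(ω)`, a.s.
    (mω : Ω → ℕ) (hmωmeas : Measurable[F 0] mω)
    (hmω : ∀ᵐ ω ∂P, ∀ m, mω ω ≤ m → ω ∈ Ωs m) :
    ∃ ξ : Ω → V, Measurable[F 0] ξ ∧ (∀ ω, ξ ω ∈ Y ω) ∧
      (∀ᵐ ω ∂P, ξ (T ω) = f ω (ξ ω)) ∧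
      (∀ᵐ ω ∂P, ∀ ε : ℝ, 0 < ε → ∃ M : ℕ, ∀ m : ℕ, M ≤ m → mω ω ≤ m →
        ∀ x ∈ X ((⇑T.symm)^[m + 1] ω), ρ ω (ξ ω) (backComp (⇑T.symm) f m ω x) < ε) := by
  have hF1 : F 1 = (F 0).comap T := by simpa using hFshift 0
  have hS1 : @Measurable Ω Ω (F 0) (F 1) T.symm := by
    intro s hs
    rw [hF1] at hs
    obtain ⟨t, ht, rfl⟩ := hs
    rwa [← Set.preimage_comp, T.self_comp_symm, Set.preimage_id]
  have hS0 : @Measurable Ω Ω (F 0) (F 0) T.symm := fun s hs =>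
    hS1 (hFmono zero_le_one s hs)
  have hSP : @MeasurePreserving Ω Ω (F 0) (F 0) T.symm (P.trim (hFle 0)) (P.trim (hFle 0)) := by
    refine @MeasurePreserving.mk Ω Ω (F 0) (F 0) _ _ _ hS0 ?_
    refine @Measure.ext Ω (F 0) _ _ fun s hs => ?_
    rw [@Measure.map_apply Ω Ω (F 0) (F 0) _ _ hS0 _ hs, trim_measurableSet_eq _ hs,
      trim_measurableSet_eq _ (hS0 hs),
      ← hTP.measure_preimage (hTinv (hFle 0 s hs)).nullMeasurableSet, ← Set.preimage_comp, T.symm_comp_self, Set.preimage_id]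
  have htrim {s : Set Ω} (hs : P s = 0) : P.trim (hFle 0) s = 0 := by
    rwa [trim_measurableSet_eq _ (hFnull 0 s hs)]
  have hcomplete : @Measure.IsComplete Ω (F 0) (P.trim (hFle 0)) :=
    @Measure.IsComplete.mk Ω (F 0) _ fun s hs => hFnull 0 s (measure_eq_zero_of_trim_eq_zero _ hs)
  have hf : ∀ ω, ∀ x ∈ X (T.symm ω), f (T.symm ω) x ∈ X ω := fun ω x hx => by
    simpa using hfmaps _ x hx
  obtain ⟨v₀, -⟩ : (X (nonempty_of_isProbabilityMeasure P).some).Nonempty := hXne _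
  let Fbar : Ω × V → V := fun p => Sum.elim id (fun _ => v₀)
    (if p.2 ∈ X (T.symm p.1) then Sum.inl (f (T.symm p.1) p.2) else Sum.inr ())
  have hFbar : @Measurable (Ω × V) V ((F 0).prod inferInstance) inferInstance Fbar := by
    have h : @Measurable (Ω × V) (Ω × V) ((F 0).prod inferInstance) ((F 1).prod inferInstance)
        (fun p => (T.symm p.1, p.2)) :=
      @Measurable.prodMk (Ω × V) ((F 0).prod inferInstance) Ω V (F 1) _ _ _
        (@Measurable.comp _ _ _ ((F 0).prod inferInstance) (F 0) (F 1) _ _ hS1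
          (@measurable_fst Ω V (F 0) _))
        (@measurable_snd Ω V (F 0) _)
    exact (measurable_id.sumElim measurable_const).comp (hA1.comp h)
  let metric : ∀ ω, MetricSpace (Y ω) := fun ω =>
    { dist := fun x y => ρ ω x y
      dist_self := fun x => (hρmetric ω x x.2 x x.2).2.1.2 rfl
      dist_comm := fun x y => (hρmetric ω x x.2 y y.2).2.2
      dist_triangle := fun x y z => hρtriangle ω x x.2 y y.2 z z.2
      eq_of_dist_eq_zero := fun {x y} h => Subtype.ext ((hρmetric ω x x.2 y y.2).2.1.1 h) }
  have hcontr : ∀ m, ∀ ω ∈ Ωs m, IsContractingAt T.symm f X Y m ω := by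
    intro m ω hω
    obtain ⟨hsub, hcpt⟩ := hA3a m ω hω
    refine ⟨hsub, IsSeqCompact.isCompact fun u hu => ?_, ?_⟩
    · obtain ⟨z, hz, σ, hσ, hlim⟩ := hcpt (fun k => u k) hu
      refine ⟨⟨z, hsub hz⟩, hz, σ, hσ, tendsto_iff_dist_tendsto_zero.2 ?_⟩
      simp_rw [dist_comm _ (⟨z, hsub hz⟩ : Y ω)]
      exact hlim
    · rintro x x' y y' hxy hxy' hne
      have h := hA3b m ω hω x x.2 x' x'.2 fun h => hne (Subtype.ext h)
      rw [hxy, hxy'] at h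
      exact h
  have hgood : ∀ᵐ ω ∂P, ∃ M, ∀ m, M ≤ m → ω ∈ Ωs m := hmω.mono fun ω h => ⟨_, h⟩
  have hprob : @IsProbabilityMeasure Ω (F 0) (P.trim (hFle 0)) :=
    @IsProbabilityMeasure.mk Ω (F 0) _
      ((trim_measurableSet_eq _ (@MeasurableSet.univ Ω (F 0))).trans measure_univ)
  obtain ⟨ξ, hξmeas, hξfix, hξlim⟩ := @exists_stochastic_fixed_point_of_pullback Ω V (F 0) _
    T.symm f X Y _ (P.trim (hFle 0)) hprob hcomplete hSP hXgraph hXne hf Fbar hFbar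
    (fun ω x hx => by simp [Fbar, hx]) hYsub hYne hA2a metric _ hA2b
    (fun ω y y' => if_pos ⟨y.2, y'.2⟩) Ωs hΩmeas
    (by simpa only [trim_measurableSet_eq _ (hΩmeas _)] using hΩP) hcontr (htrim hgood)
  refine ⟨fun ω => ξ ω, hξmeas, fun ω => (ξ ω).2, ?_, ?_⟩
  · filter_upwards [hTP.quasiMeasurePreserving.ae (ae_of_ae_trim _ hξfix)] with ω hω
    rwa [T.symm_apply_apply] at hω
  · filter_upwards [ae_of_ae_trim _ hξlim, hmω] with ω hω hωm ε hε
    obtain ⟨M, hM⟩ := hω ε hε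
    refine ⟨M, fun m hm hmω x hx => ?_⟩
    have hmem : backComp T.symm f m ω x ∈ backRange T.symm f X m ω := ⟨x, hx, rfl⟩
    exact hM m hm ⟨_, (hcontr m ω (hωm m hmω)).subset hmem⟩ hmem
end
end
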